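/- Let n ≥ 2 and 0 < μ < n. Suppose u ∈ Cⁿ(ℝⁿ) satisfies condition (B) and the integral equation (IE). Then for every b ∈ ℝⁿ one has λ_b > 0, and moreover w_{λ_b,b}(x) = 0 and z_{λ_b,b}(x) = 0 for every x ∈ ℝⁿ with 0 < |x| < λ_b. -/

import Mathlib

open MeasureTheory Real Filter Metric

noncomputable section

/-- The nonlocal term `v(x) = ∫ e^{((2n-μ)/2) u(y)} / |x-y|^μ dy`. -/
noncomputable def V (n : ℕ) (μ : ℝ) (u : EuclideanSpace ℝ (Fin n) → ℝ)
    (x : EuclideanSpace ℝ (Fin n)) : ℝ :=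
  ∫ y : EuclideanSpace ℝ (Fin n),
    Real.exp ((2 * n - μ) / 2 * u y) / ‖x - y‖ ^ μ

/-- `βₙ = 2^{n-1} Γ(n/2+1) Γ(n/2) ωₙ` with `ωₙ` the volume of the unit ball in `ℝⁿ`. -/
noncomputable def betaN (n : ℕ) : ℝ :=
  2 ^ (n - 1) * Real.Gamma ((n : ℝ) / 2 + 1) * Real.Gamma ((n : ℝ) / 2) *
    (volume (Metric.ball (0 : EuclideanSpace ℝ (Fin n)) 1)).toReal

/-- Condition (B): finite weighted volume and finite total curvature. -/
def CondB (n : ℕ) (μ : ℝ) (u : EuclideanSpace ℝ (Fin n) → ℝ) : Prop :=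
  Integrable (fun y : EuclideanSpace ℝ (Fin n) => Real.exp ((2 * n - μ) / 2 * u y)) ∧
  Integrable (fun p : EuclideanSpace ℝ (Fin n) × EuclideanSpace ℝ (Fin n) =>
    Real.exp ((2 * n - μ) / 2 * u p.1) * Real.exp ((2 * n - μ) / 2 * u p.2) / ‖p.1 - p.2‖ ^ μ)

/-- The integral equation (IE). -/
def IE (n : ℕ) (μ : ℝ) (u : EuclideanSpace ℝ (Fin n) → ℝ) : Prop :=
  ∃ C : ℝ, ∀ x : EuclideanSpace ℝ (Fin n), u x = (1 / betaN n) *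
    (∫ y, Real.log ((‖y‖ + 1) / ‖x - y‖) * (V n μ u y * Real.exp ((2 * n - μ) / 2 * u y))) + C

/-- `α = (1/βₙ) ∫ v(y) e^{((2n-μ)/2) u(y)} dy`. -/
noncomputable def alphaC (n : ℕ) (μ : ℝ) (u : EuclideanSpace ℝ (Fin n) → ℝ) : ℝ :=
  (1 / betaN n) * ∫ y, V n μ u y * Real.exp ((2 * n - μ) / 2 * u y)

/-- `w_{λ,b}(x) = u(b + x/|x|²) − 2 ln|x| − u(b + x/λ²) + 2 ln λ`. -/
noncomputable def wMS (n : ℕ) (u : EuclideanSpace ℝ (Fin n) → ℝ)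
    (b : EuclideanSpace ℝ (Fin n)) (l : ℝ) (x : EuclideanSpace ℝ (Fin n)) : ℝ :=
  u (b + (‖x‖ ^ 2)⁻¹ • x) - 2 * Real.log ‖x‖ - u (b + (l ^ 2)⁻¹ • x) + 2 * Real.log l

/-- `z_{λ,b}(x) = |x|^{−μ} v(b + x/|x|²) − λ^{−μ} v(b + x/λ²)`. -/
noncomputable def zMS (n : ℕ) (μ : ℝ) (u : EuclideanSpace ℝ (Fin n) → ℝ)
    (b : EuclideanSpace ℝ (Fin n)) (l : ℝ) (x : EuclideanSpace ℝ (Fin n)) : ℝ :=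
  ‖x‖ ^ (-μ) * V n μ u (b + (‖x‖ ^ 2)⁻¹ • x) - l ^ (-μ) * V n μ u (b + (l ^ 2)⁻¹ • x)

/-- The critical moving-spheres radius `λ_b`. -/
noncomputable def lambdaB (n : ℕ) (μ : ℝ) (u : EuclideanSpace ℝ (Fin n) → ℝ)
    (b : EuclideanSpace ℝ (Fin n)) : ℝ :=
  sInf {l : ℝ | 0 < l ∧ ∀ ρ : ℝ, l ≤ ρ → ∀ x : EuclideanSpace ℝ (Fin n),
    0 < ‖x‖ → ‖x‖ < ρ → 0 ≤ wMS n u b ρ x ∧ 0 ≤ zMS n μ u b ρ x}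

open scoped Topology

/-- Euclidean `n`-space. -/
abbrev Euc (n : ℕ) := EuclideanSpace ℝ (Fin n)

lemma integrableOn_ball_norm_rpow_neg {n : ℕ} (hn : 0 < n) {s : ℝ} (hs : s < n) :
    IntegrableOn (fun z : Euc n => ‖z‖ ^ (-s)) (ball 0 1) := by
  have : Nontrivial (Euc n) := by
    have : Nonempty (Fin n) := ⟨⟨0, hn⟩⟩
    infer_instance
  rw [integrableOn_fun_norm_addHaar volume (f := fun t : ℝ => t ^ (-s)) (r := 1)]
  have h1 : IntegrableOn (fun t : ℝ => t ^ ((n : ℝ) - 1 - s)) (Set.Ioo 0 1) := by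
    rw [intervalIntegral.integrableOn_Ioo_rpow_iff one_pos]
    linarith
  refine h1.congr_fun (fun t ht => ?_) measurableSet_Ioo
  have hc : ((n - 1 : ℕ) : ℝ) = (n : ℝ) - 1 := by
    rw [Nat.cast_sub hn]; simp
  simp only [finrank_euclideanSpace, Fintype.card_fin, smul_eq_mul]
  rw [← Real.rpow_natCast, ← Real.rpow_add ht.1, hc]
  ring_nf

/-- The mass of the kernel `‖z‖ ^ (-s)` in the unit ball. -/
def kerMass (n : ℕ) (s : ℝ) : ℝ := ∫ z in ball (0 : Euc n) 1, ‖z‖ ^ (-s)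

/-- Convolution of `‖z‖ ^ (-s)` with an integrable function that is bounded near `x`. -/
lemma integrable_norm_rpow_neg_mul {n : ℕ} (hn : 0 < n) {s : ℝ} (hs0 : 0 ≤ s) (hs : s < n)
    {h : Euc n → ℝ} (h0 : ∀ y, 0 ≤ h y) (hi : Integrable h) {x : Euc n} {M : ℝ}
    (hM : ∀ y ∈ ball x 1, h y ≤ M) :
    Integrable (fun y => ‖x - y‖ ^ (-s) * h y) ∧
      ∫ y, ‖x - y‖ ^ (-s) * h y ≤ M * kerMass n s + ∫ y, h y := by
  have hk := (integrableOn_ball_norm_rpow_neg hn hs)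
  rw [← integrable_indicator_iff measurableSet_ball] at hk
  have hk' := (hk.comp_sub_left x).const_mul M
  have hle : ∀ y, ‖x - y‖ ^ (-s) * h y ≤
      M * (ball (0 : Euc n) 1).indicator (fun z => ‖z‖ ^ (-s)) (x - y) + h y := by
    intro y
    by_cases hy : x - y ∈ ball (0 : Euc n) 1
    · rw [Set.indicator_of_mem hy]
      have : h y ≤ M := hM y (by rw [mem_ball_zero_iff] at hy; rwa [mem_ball', dist_eq_norm])
      have h2 : 0 ≤ ‖x - y‖ ^ (-s) := by positivity
      nlinarith [h0 y]
    · rw [Set.indicator_of_notMem hy]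
      have h1 : 1 ≤ ‖x - y‖ := by simpa using hy
      have : ‖x - y‖ ^ (-s) ≤ 1 := Real.rpow_le_one_of_one_le_of_nonpos h1 (by linarith)
      nlinarith [h0 y]
  have hint : Integrable (fun y => ‖x - y‖ ^ (-s) * h y) := by
    refine (hk'.add hi).mono' ?_ (ae_of_all _ fun y => ?_)
    · refine AEStronglyMeasurable.mul ?_ hi.aestronglyMeasurable
      exact (by fun_prop : Measurable fun y => ‖x - y‖ ^ (-s)).aestronglyMeasurable
    · rw [Real.norm_of_nonneg (mul_nonneg (by positivity) (h0 y))]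
      exact hle y
  refine ⟨hint, (integral_mono hint (hk'.add hi) hle).trans_eq ?_⟩
  rw [integral_add' hk' hi, integral_const_mul,
    integral_sub_left_eq_self (fun z => (ball (0 : Euc n) 1).indicator (fun z => ‖z‖ ^ (-s)) z),
    integral_indicator measurableSet_ball, kerMass]

lemma kerMass_nonneg (n : ℕ) (s : ℝ) : 0 ≤ kerMass n s :=
  integral_nonneg fun _ => by positivity

lemma abs_log_div_le {n : ℕ} (x y : Euc n) (hxy : x ≠ y) :
    |log ((‖y‖ + 1) / ‖x - y‖)| ≤ log (‖x‖ + 2) + 2 * ‖x - y‖ ^ (-(1 / 2 : ℝ)) := by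
  have hd : 0 < ‖x - y‖ := norm_pos_iff.2 (sub_ne_zero.2 hxy)
  have hx := norm_nonneg x
  have hy := norm_nonneg y
  have h1 : ‖x - y‖ ≤ ‖x‖ + ‖y‖ := norm_sub_le x y
  have h2 : ‖y‖ ≤ ‖x‖ + ‖x - y‖ := by
    have := norm_sub_le x (x - y); simpa using this
  have h3 : 0 ≤ ‖x - y‖ ^ (-(1 / 2 : ℝ)) := by positivity
  have hlog : 0 ≤ log (‖x‖ + 2) := log_nonneg (by linarith)
  rw [abs_le]
  constructor
  · have : log (‖x - y‖ / (‖y‖ + 1)) ≤ log (‖x‖ + 2) := by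
      apply log_le_log (by positivity)
      rw [div_le_iff₀ (by positivity)]
      nlinarith
    rw [← inv_div ‖x - y‖, log_inv]
    linarith
  · rcases le_total ‖x - y‖ 1 with h | h
    · rw [log_div (by positivity) (by positivity)]
      have h4 : log (‖y‖ + 1) ≤ log (‖x‖ + 2) := log_le_log (by positivity) (by linarith)
      have h5 := Real.log_le_rpow_div (x := ‖x - y‖⁻¹) (by positivity) (ε := 1 / 2) (by norm_num)
      rw [log_inv, Real.inv_rpow hd.le, ← Real.rpow_neg hd.le] at h5
      linarith
    · have : log ((‖y‖ + 1) / ‖x - y‖) ≤ log (‖x‖ + 2) := by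
        apply log_le_log (by positivity)
        rw [div_le_iff₀ (by positivity)]
        nlinarith
      linarith

/-- The density `e^{((2n-μ)/2) u}`. -/
def dens (n : ℕ) (μ : ℝ) (u : Euc n → ℝ) (y : Euc n) : ℝ :=
  Real.exp ((2 * n - μ) / 2 * u y)

/-- The density `v e^{((2n-μ)/2) u}`. -/
def curv (n : ℕ) (μ : ℝ) (u : Euc n → ℝ) (y : Euc n) : ℝ :=
  V n μ u y * dens n μ u y

section Densities

variable {n : ℕ} {μ : ℝ} {u : Euc n → ℝ}

lemma dens_pos (y : Euc n) : 0 < dens n μ u y := Real.exp_pos _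

lemma continuous_dens (hu : Continuous u) : Continuous (dens n μ u) := by
  unfold dens; fun_prop

lemma V_eq (x : Euc n) : V n μ u x = ∫ y, ‖x - y‖ ^ (-μ) * dens n μ u y := by
  unfold V dens
  congr 1
  ext y
  rw [Real.rpow_neg (norm_nonneg _), div_eq_mul_inv, mul_comm]

lemma V_nonneg (x : Euc n) : 0 ≤ V n μ u x :=
  integral_nonneg fun _ => by positivity

lemma exists_bound_on_ball {h : Euc n → ℝ} (hc : Continuous h) (R : ℝ) :
    ∃ M, 0 ≤ M ∧ ∀ y, ‖y‖ ≤ R → |h y| ≤ M := by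
  obtain ⟨C, hC⟩ := (isCompact_closedBall (0 : Euc n) R).exists_bound_of_continuousOn
    hc.continuousOn
  exact ⟨max C 0, le_max_right _ _, fun y hy =>
    (hC y (by simpa using hy)).trans (le_max_left _ _)⟩

lemma integrable_rpow_mul_dens (hn : 0 < n) (hμ0 : 0 < μ) (hμn : μ < n) (hu : Continuous u)
    (hf : Integrable (dens n μ u)) (x : Euc n) :
    Integrable (fun y => ‖x - y‖ ^ (-μ) * dens n μ u y) := by
  obtain ⟨M, -, hM⟩ := exists_bound_on_ball (continuous_dens (μ := μ) hu) (‖x‖ + 1)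
  refine (integrable_norm_rpow_neg_mul hn hμ0.le hμn (fun y => (dens_pos y).le) hf
    (x := x) (M := M) fun y hy => (le_abs_self _).trans (hM y ?_)).1
  have := norm_le_norm_add_norm_sub' y x
  rw [mem_ball, dist_eq_norm] at hy
  linarith

lemma exists_bound_V (hn : 0 < n) (hμ0 : 0 < μ) (hμn : μ < n) (hu : Continuous u)
    (hf : Integrable (dens n μ u)) (R : ℝ) :
    ∃ M, 0 ≤ M ∧ ∀ y, ‖y‖ ≤ R → V n μ u y ≤ M := by
  obtain ⟨M, hM0, hM⟩ := exists_bound_on_ball (continuous_dens (μ := μ) hu) (R + 1)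
  refine ⟨M * kerMass n μ + ∫ y, dens n μ u y, ?_, fun x hx => ?_⟩
  · exact add_nonneg (mul_nonneg hM0 (kerMass_nonneg _ _))
      (integral_nonneg fun y => (dens_pos y).le)
  · rw [V_eq]
    refine (integrable_norm_rpow_neg_mul hn hμ0.le hμn (fun y => (dens_pos y).le) hf
      (x := x) (M := M) fun y hy => (le_abs_self _).trans (hM y ?_)).2
    have := norm_le_norm_add_norm_sub' y x
    rw [mem_ball, dist_eq_norm] at hy
    linarith

lemma V_pos (hn : 0 < n) (hμ0 : 0 < μ) (hμn : μ < n) (hu : Continuous u)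
    (hf : Integrable (dens n μ u)) (x : Euc n) : 0 < V n μ u x := by
  rw [V_eq, integral_pos_iff_support_of_nonneg
    (fun y => mul_nonneg (by positivity) (dens_pos y).le)
    (integrable_rpow_mul_dens hn hμ0 hμn hu hf x)]
  have hsub : ball x 1 \ {x} ⊆ Function.support fun y => ‖x - y‖ ^ (-μ) * dens n μ u y := by
    intro y hy
    have : 0 < ‖x - y‖ := norm_pos_iff.2 (sub_ne_zero.2 (Ne.symm hy.2))
    exact (mul_pos (by positivity) (dens_pos y)).ne'
  refine lt_of_lt_of_le ?_ (measure_mono hsub)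
  have : Nonempty (Fin n) := ⟨⟨0, hn⟩⟩
  rw [measure_sdiff_null (measure_singleton x)]
  exact measure_ball_pos _ _ one_pos

lemma stronglyMeasurable_V (hu : Continuous u) : StronglyMeasurable (V n μ u) := by
  have : StronglyMeasurable (Function.uncurry fun x y : Euc n =>
      Real.exp ((2 * n - μ) / 2 * u y) / ‖x - y‖ ^ μ) := by
    apply Measurable.stronglyMeasurable
    have := hu.measurable
    unfold Function.uncurry
    fun_prop
  exact this.integral_prod_right

lemma curv_nonneg (y : Euc n) : 0 ≤ curv n μ u y := mul_nonneg (V_nonneg y) (dens_pos y).le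

lemma stronglyMeasurable_curv (hu : Continuous u) : StronglyMeasurable (curv n μ u) :=
  (stronglyMeasurable_V hu).mul (continuous_dens hu).stronglyMeasurable

lemma integrable_curv (hB : CondB n μ u) : Integrable (curv n μ u) := by
  have h := hB.2.integral_prod_left
  refine h.congr (ae_of_all _ fun x => ?_)
  simp only [curv, V, dens]
  rw [← integral_mul_const]
  congr 1
  ext y
  ring

lemma integral_prod_dens (hB : CondB n μ u) :
    ∫ p : Euc n × Euc n, ‖p.1 - p.2‖ ^ (-μ) * (dens n μ u p.1 * dens n μ u p.2) =
      ∫ x, curv n μ u x := by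
  have h := hB.2
  have he : (fun p : Euc n × Euc n => ‖p.1 - p.2‖ ^ (-μ) * (dens n μ u p.1 * dens n μ u p.2)) =
    fun p => Real.exp ((2 * n - μ) / 2 * u p.1) * Real.exp ((2 * n - μ) / 2 * u p.2) /
      ‖p.1 - p.2‖ ^ μ := by
    ext p
    rw [Real.rpow_neg (norm_nonneg _)]
    simp only [dens]
    ring
  rw [he, Measure.volume_eq_prod, integral_prod _ h]
  congr 1
  ext x
  simp only [curv, V, dens]
  rw [← integral_mul_const]
  congr 1
  ext y
  ring

lemma integrable_prod_dens (hB : CondB n μ u) :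
    Integrable (fun p : Euc n × Euc n =>
      ‖p.1 - p.2‖ ^ (-μ) * (dens n μ u p.1 * dens n μ u p.2)) := by
  refine hB.2.congr (ae_of_all _ fun p => ?_)
  simp only [dens]
  rw [Real.rpow_neg (norm_nonneg _)]
  ring

lemma exists_bound_curv (hn : 0 < n) (hμ0 : 0 < μ) (hμn : μ < n) (hu : Continuous u)
    (hf : Integrable (dens n μ u)) (R : ℝ) :
    ∃ M, 0 ≤ M ∧ ∀ y, ‖y‖ ≤ R → curv n μ u y ≤ M := by
  obtain ⟨M, hM0, hM⟩ := exists_bound_on_ball (continuous_dens (μ := μ) hu) R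
  obtain ⟨M', hM0', hM'⟩ := exists_bound_V hn hμ0 hμn hu hf R
  exact ⟨M' * M, mul_nonneg hM0' hM0, fun y hy =>
    mul_le_mul (hM' y hy) ((le_abs_self _).trans (hM y hy)) (dens_pos y).le hM0'⟩

lemma integrable_rpow_mul_curv (hn : 0 < n) (hμ0 : 0 < μ) (hμn : μ < n) (hu : Continuous u)
    (hB : CondB n μ u) {s : ℝ} (hs0 : 0 ≤ s) (hs : s < n) (x : Euc n) :
    Integrable (fun y => ‖x - y‖ ^ (-s) * curv n μ u y) := by
  obtain ⟨M, -, hM⟩ := exists_bound_curv hn hμ0 hμn hu hB.1 (‖x‖ + 1)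
  refine (integrable_norm_rpow_neg_mul hn hs0 hs curv_nonneg (integrable_curv hB)
    (x := x) (M := M) fun y hy => hM y ?_).1
  have := norm_le_norm_add_norm_sub' y x
  rw [mem_ball, dist_eq_norm] at hy
  linarith

lemma ae_ne_point (hn : 0 < n) (x : Euc n) : ∀ᵐ y : Euc n, x ≠ y := by
  have : Nonempty (Fin n) := ⟨⟨0, hn⟩⟩
  have : ∀ᵐ y : Euc n, y ∉ ({x} : Set (Euc n)) :=
    measure_eq_zero_iff_ae_notMem.1 (measure_singleton x)
  filter_upwards [this] with y hy h
  exact hy h.symm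

lemma integrable_log_mul_curv (hn : 0 < n) (hμ0 : 0 < μ) (hμn : μ < n) (hu : Continuous u)
    (hB : CondB n μ u) (x : Euc n) :
    Integrable (fun y => log ((‖y‖ + 1) / ‖x - y‖) * curv n μ u y) := by
  have hn1 : (1 : ℝ) ≤ n := by exact_mod_cast hn
  refine (((integrable_curv hB).const_mul (log (‖x‖ + 2))).add
    ((integrable_rpow_mul_curv hn hμ0 hμn hu hB (s := 1 / 2) (by norm_num)
      (by linarith) x).const_mul 2)).mono' ?_ ?_
  · refine AEStronglyMeasurable.mul ?_ (stronglyMeasurable_curv hu).aestronglyMeasurable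
    exact (by fun_prop : Measurable fun y => log ((‖y‖ + 1) / ‖x - y‖)).aestronglyMeasurable
  · filter_upwards [ae_ne_point hn x] with y hy
    rw [norm_mul, Real.norm_eq_abs, Real.norm_of_nonneg (curv_nonneg y)]
    refine (mul_le_mul_of_nonneg_right (abs_log_div_le x y hy) (curv_nonneg y)).trans_eq ?_
    simp only [Pi.add_apply]
    ring

lemma betaN_pos (n : ℕ) (hn : 0 < n) : 0 < betaN n := by
  have : Nonempty (Fin n) := ⟨⟨0, hn⟩⟩
  have hn' : (0 : ℝ) < n := by exact_mod_cast hn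
  have h : 0 < (volume (ball (0 : Euc n) 1)).toReal :=
    ENNReal.toReal_pos (measure_ball_pos _ _ one_pos).ne' measure_ball_lt_top.ne
  have h1 := Real.Gamma_pos_of_pos (show 0 < (n : ℝ) / 2 + 1 by positivity)
  have h2 := Real.Gamma_pos_of_pos (show 0 < (n : ℝ) / 2 by positivity)
  unfold betaN
  positivity

end Densities

section Potentials

variable {n : ℕ}

/-- Differentiation under the integral sign for potentials of kernels with bounded gradient. -/
lemma hasFDerivAt_potential {k c h : Euc n → ℝ} (hk : ContDiff ℝ 1 k) {B : ℝ}
    (hB : ∀ z, ‖fderiv ℝ k z‖ ≤ B) (hh : Integrable h)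
    (hi : ∀ x, Integrable fun y => (k (x - y) - c y) * h y) (x : Euc n) :
    HasFDerivAt (fun x => ∫ y, (k (x - y) - c y) * h y) (∫ y, h y • fderiv ℝ k (x - y)) x := by
  have hk' := hk.continuous_fderiv one_ne_zero
  refine hasFDerivAt_integral_of_dominated_of_fderiv_le (𝕜 := ℝ)
    (F' := fun x y => h y • fderiv ℝ k (x - y)) (bound := fun y => |h y| * B)
    (s := Set.univ) univ_mem (Eventually.of_forall fun x => (hi x).aestronglyMeasurable) (hi x)
    ?_ (ae_of_all _ fun y z _ => ?_) (hh.abs.mul_const _) (ae_of_all _ fun y z _ => ?_)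
  · exact hh.aestronglyMeasurable.smul
      (by fun_prop : Continuous fun y => fderiv ℝ k (x - y)).aestronglyMeasurable
  · rw [norm_smul, Real.norm_eq_abs]
    exact mul_le_mul_of_nonneg_left (hB _) (abs_nonneg _)
  · have h1 : HasFDerivAt (fun x => k (x - y)) (fderiv ℝ k (z - y)) z := by
      have h2 := ((hk.differentiable (by simp)) (z - y)).hasFDerivAt
      exact (hasFDerivAt_comp_sub (f := k) y).2 h2
    exact (h1.sub_const (c y)).mul_const (h y)

lemma continuous_fderiv_potential {k h : Euc n → ℝ} (hk : ContDiff ℝ 1 k) {B : ℝ}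
    (hB : ∀ z, ‖fderiv ℝ k z‖ ≤ B) (hh : Integrable h) :
    Continuous fun x => ∫ y, h y • fderiv ℝ k (x - y) := by
  have hk' := hk.continuous_fderiv one_ne_zero
  refine continuous_of_dominated (bound := fun y => |h y| * B) (fun x => ?_)
    (fun x => ae_of_all _ fun y => ?_) (hh.abs.mul_const _) (ae_of_all _ fun y => by fun_prop)
  · exact hh.aestronglyMeasurable.smul
      (by fun_prop : Continuous fun y => fderiv ℝ k (x - y)).aestronglyMeasurable
  · rw [norm_smul, Real.norm_eq_abs]
    exact mul_le_mul_of_nonneg_left (hB _) (abs_nonneg _)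

lemma norm_mul_inv_sq_add_le {t e : ℝ} (he : 0 < e) :
    t * (t ^ 2 + e)⁻¹ ≤ 1 + e⁻¹ := by
  rw [← div_eq_mul_inv, div_le_iff₀ (by positivity)]
  have : e⁻¹ * e = 1 := inv_mul_cancel₀ he.ne'
  have h2 : 0 ≤ e⁻¹ * t ^ 2 := by positivity
  nlinarith [sq_nonneg (t - 1)]

/-- The regularized logarithmic kernel. -/
def logKer (e : ℝ) (z : Euc n) : ℝ := 1 / 2 * log (‖z‖ ^ 2 + e)

/-- The regularized Riesz kernel. -/
def rieszKer (μ e : ℝ) (z : Euc n) : ℝ := (‖z‖ ^ 2 + e) ^ (-μ / 2)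

lemma contDiff_logKer {e : ℝ} (he : 0 < e) : ContDiff ℝ 1 (logKer e : Euc n → ℝ) := by
  unfold logKer
  refine contDiff_const.mul (ContDiff.log ((contDiff_norm_sq ℝ).add contDiff_const) fun z => ?_)
  positivity

lemma contDiff_rieszKer (μ : ℝ) {e : ℝ} (he : 0 < e) :
    ContDiff ℝ 1 (rieszKer μ e : Euc n → ℝ) := by
  unfold rieszKer
  refine ContDiff.rpow_const_of_ne ((contDiff_norm_sq ℝ).add contDiff_const) fun z => ?_
  positivity

lemma fderiv_logKer {e : ℝ} (he : 0 < e) (z : Euc n) :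
    fderiv ℝ (logKer e) z = (‖z‖ ^ 2 + e)⁻¹ • innerSL ℝ z := by
  have h1 := (hasStrictFDerivAt_norm_sq z).hasFDerivAt.add_const e
  have h2 := (h1.log (by positivity)).const_mul (1 / 2)
  refine (HasFDerivAt.fderiv h2).trans ?_
  ext w
  simp
  ring

lemma fderiv_rieszKer (μ : ℝ) {e : ℝ} (he : 0 < e) (z : Euc n) :
    fderiv ℝ (rieszKer μ e) z = (-μ * (‖z‖ ^ 2 + e) ^ (-μ / 2 - 1)) • innerSL ℝ z := by
  have h1 := (hasStrictFDerivAt_norm_sq z).hasFDerivAt.add_const e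
  have h2 := h1.rpow_const (p := -μ / 2) (Or.inl (by positivity))
  refine (HasFDerivAt.fderiv h2).trans ?_
  ext w
  simp
  ring

lemma norm_fderiv_logKer_le {e : ℝ} (he : 0 < e) (z : Euc n) :
    ‖fderiv ℝ (logKer e) z‖ ≤ 1 + e⁻¹ := by
  rw [fderiv_logKer he, norm_smul, innerSL_apply_norm, Real.norm_of_nonneg (by positivity),
    mul_comm]
  exact norm_mul_inv_sq_add_le he

lemma norm_fderiv_rieszKer_le {μ : ℝ} (hμ : 0 < μ) {e : ℝ} (he : 0 < e) (z : Euc n) :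
    ‖fderiv ℝ (rieszKer μ e) z‖ ≤ μ * e ^ (-μ / 2) * (1 + e⁻¹) := by
  have hz : 0 < ‖z‖ ^ 2 + e := by positivity
  rw [fderiv_rieszKer μ he, norm_smul, innerSL_apply_norm, norm_mul, norm_neg,
    Real.norm_of_nonneg hμ.le, Real.norm_of_nonneg (by positivity), Real.rpow_sub_one hz.ne']
  have h1 : (‖z‖ ^ 2 + e) ^ (-μ / 2) ≤ e ^ (-μ / 2) :=
    Real.rpow_le_rpow_of_nonpos he (by nlinarith [sq_nonneg ‖z‖]) (by linarith)
  have h2 := norm_mul_inv_sq_add_le (t := ‖z‖) he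
  calc μ * ((‖z‖ ^ 2 + e) ^ (-μ / 2) / (‖z‖ ^ 2 + e)) * ‖z‖
      = μ * (‖z‖ ^ 2 + e) ^ (-μ / 2) * (‖z‖ * (‖z‖ ^ 2 + e)⁻¹) := by ring
    _ ≤ _ := by gcongr

lemma norm_gradKer_sub_le {z : Euc n} (hz : z ≠ 0) {e : ℝ} (he : 0 < e) :
    ‖(‖z‖ ^ 2 + e ^ 4)⁻¹ • innerSL ℝ z - (‖z‖ ^ 2)⁻¹ • innerSL ℝ z‖ ≤
      e * ‖z‖ ^ (-(3 / 2) : ℝ) := by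
  have hz0 : 0 < ‖z‖ := norm_pos_iff.2 hz
  rw [← sub_smul, norm_smul, innerSL_apply_norm]
  obtain ⟨t, ht, hzt⟩ : ∃ t : ℝ, 0 < t ∧ ‖z‖ = t ^ 2 :=
    ⟨√‖z‖, by positivity, (Real.sq_sqrt hz0.le).symm⟩
  have h32 : ‖z‖ ^ (-(3 / 2) : ℝ) = (t ^ 3)⁻¹ := by
    rw [hzt, ← Real.rpow_natCast, ← Real.rpow_mul ht.le, ← Real.rpow_natCast,
      ← Real.rpow_neg ht.le]
    norm_num
  rw [h32, hzt, Real.norm_eq_abs, abs_sub_comm, inv_sub_inv (by positivity) (by positivity),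
    abs_of_nonneg (by ring_nf; positivity), div_mul_eq_mul_div, div_le_iff₀ (by positivity),
    ← div_eq_mul_inv, div_mul_eq_mul_div, le_div_iff₀ (by positivity)]
  have key : e ^ 3 * t ≤ t ^ 4 + e ^ 4 := by
    rcases le_total t e with h | h
    · nlinarith [pow_pos he 3, pow_pos ht 4]
    · have : e ^ 3 ≤ t ^ 3 := by gcongr
      nlinarith [pow_pos he 4]
  have : 0 < e * t ^ 4 := by positivity
  nlinarith [mul_le_mul_of_nonneg_left key this.le]

end Potentials

section Gradient

variable {n : ℕ} {μ : ℝ} {u : Euc n → ℝ}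

lemma abs_logKer_sub_le {x y : Euc n} (hxy : x ≠ y) {e : ℝ} (he : 0 < e) (he1 : e ≤ 1) :
    |logKer e (x - y) - log (‖y‖ + 1)| ≤
      2 * log (‖x‖ + 2) + 2 * ‖x - y‖ ^ (-(1 / 2 : ℝ)) := by
  have hd : 0 < ‖x - y‖ := norm_pos_iff.2 (sub_ne_zero.2 hxy)
  have hx := norm_nonneg x
  have hy := norm_nonneg y
  have hlog : 0 ≤ log (‖x‖ + 2) := log_nonneg (by linarith)
  have h3 : 0 ≤ ‖x - y‖ ^ (-(1 / 2 : ℝ)) := by positivity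
  have h0 := abs_le.1 (abs_log_div_le x y hxy)
  rw [log_div (by positivity) (by positivity)] at h0
  have h1 : ‖x - y‖ ≤ ‖x‖ + ‖y‖ := norm_sub_le x y
  unfold logKer
  rw [abs_le]
  constructor
  · have : log (‖x - y‖ ^ 2) ≤ log (‖x - y‖ ^ 2 + e) :=
      log_le_log (by positivity) (by linarith)
    rw [log_pow] at this
    push_cast at this
    linarith [h0.2]
  · have h4 : log (‖x - y‖ ^ 2 + e) ≤ log (((‖x‖ + 2) * (‖y‖ + 1)) ^ 2) := by
      apply log_le_log (by positivity)
      have : ‖x - y‖ + 1 ≤ (‖x‖ + 2) * (‖y‖ + 1) := by nlinarith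
      nlinarith
    rw [log_pow, log_mul (by positivity) (by positivity)] at h4
    push_cast at h4
    linarith

/-- The gradient of `u` obtained by differentiating the integral equation. -/
def gradPot (n : ℕ) (μ : ℝ) (u : Euc n → ℝ) (x : Euc n) : Euc n →L[ℝ] ℝ :=
  ∫ y, curv n μ u y • ((‖x - y‖ ^ 2)⁻¹ • innerSL ℝ (x - y))

lemma norm_curv_smul_le (x y : Euc n) :
    ‖curv n μ u y • ((‖x - y‖ ^ 2)⁻¹ • innerSL ℝ (x - y))‖ ≤
      ‖x - y‖ ^ (-1 : ℝ) * curv n μ u y := by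
  rw [norm_smul, norm_smul, innerSL_apply_norm, Real.norm_of_nonneg (curv_nonneg y),
    Real.norm_of_nonneg (by positivity), Real.rpow_neg_one, mul_comm]
  refine mul_le_mul_of_nonneg_right ?_ (curv_nonneg y)
  rcases eq_or_ne ‖x - y‖ 0 with h | h
  · simp [h]
  · apply le_of_eq
    field_simp

lemma integrable_curv_smul (hn : 2 ≤ n) (hμ0 : 0 < μ) (hμn : μ < n) (hu : Continuous u)
    (hB : CondB n μ u) (x : Euc n) :
    Integrable fun y => curv n μ u y • ((‖x - y‖ ^ 2)⁻¹ • innerSL ℝ (x - y)) := by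
  have hn2 : (2 : ℝ) ≤ n := by exact_mod_cast hn
  refine (integrable_rpow_mul_curv (by lia) hμ0 hμn hu hB (s := 1) (by norm_num)
    (by linarith) x).mono' ?_ (ae_of_all _ fun y => norm_curv_smul_le x y)
  refine (stronglyMeasurable_curv hu).aestronglyMeasurable.smul ?_
  refine AEStronglyMeasurable.smul
    (by fun_prop : Measurable fun y => (‖x - y‖ ^ 2)⁻¹).aestronglyMeasurable ?_
  exact (by fun_prop : Continuous fun y => innerSL ℝ (x - y)).aestronglyMeasurable

lemma hasFDerivAt_of_IE (hn : 2 ≤ n) (hμ0 : 0 < μ) (hμn : μ < n) (hu : Continuous u)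
    (hB : CondB n μ u) (hIE : IE n μ u) (x : Euc n) :
    HasFDerivAt u (-(1 / betaN n) • gradPot n μ u x) x := by
  have hn2 : (2 : ℝ) ≤ n := by exact_mod_cast hn
  have hn0 : 0 < n := by lia
  obtain ⟨C, hC⟩ := hIE
  set g := curv n μ u with hg
  have hgi : Integrable g := integrable_curv hB
  have hgm := (stronglyMeasurable_curv (μ := μ) hu).aestronglyMeasurable (μ := volume)
  let e : ℕ → ℝ := fun k => 1 / ((k : ℝ) + 1)
  have he0 : ∀ k, 0 < e k := fun k => Nat.one_div_pos_of_nat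
  have he1 : ∀ k, e k ≤ 1 := fun k => by
    have : (0 : ℝ) ≤ k := k.cast_nonneg
    exact div_le_one_of_le₀ (by linarith) (by linarith)
  have het : Tendsto e atTop (𝓝 0) := tendsto_one_div_add_atTop_nhds_zero_nat
  let L : ℕ → Euc n → ℝ := fun k x => ∫ y, (logKer (e k ^ 4) (x - y) - log (‖y‖ + 1)) * g y
  let L' : ℕ → Euc n → Euc n →L[ℝ] ℝ := fun k x =>
    ∫ y, g y • fderiv ℝ (logKer (e k ^ 4)) (x - y)
  have hdom : ∀ x, Integrable fun y =>
      2 * log (‖x‖ + 2) * g y + 2 * (‖x - y‖ ^ (-(1 / 2 : ℝ)) * g y) := fun x =>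
    (hgi.const_mul _).add ((integrable_rpow_mul_curv hn0 hμ0 hμn hu hB (s := 1 / 2)
      (by norm_num) (by linarith) x).const_mul 2)
  have hmeas : ∀ k x, AEStronglyMeasurable
      (fun y => (logKer (e k ^ 4) (x - y) - log (‖y‖ + 1)) * g y) := fun k x => by
    refine AEStronglyMeasurable.mul ?_ hgm
    have := (contDiff_logKer (n := n) (pow_pos (he0 k) 4)).continuous
    exact (by fun_prop : Measurable fun y =>
      logKer (e k ^ 4) (x - y) - log (‖y‖ + 1)).aestronglyMeasurable
  have hbd : ∀ k x, ∀ᵐ y, ‖(logKer (e k ^ 4) (x - y) - log (‖y‖ + 1)) * g y‖ ≤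
      2 * log (‖x‖ + 2) * g y + 2 * (‖x - y‖ ^ (-(1 / 2 : ℝ)) * g y) := fun k x => by
    filter_upwards [ae_ne_point hn0 x] with y hy
    rw [norm_mul, Real.norm_of_nonneg (curv_nonneg y), Real.norm_eq_abs]
    refine (mul_le_mul_of_nonneg_right (abs_logKer_sub_le hy (pow_pos (he0 k) 4)
      (pow_le_one₀ (he0 k).le (he1 k))) (curv_nonneg y)).trans_eq ?_
    ring
  have hLd : ∀ k x, HasFDerivAt (L k) (L' k x) x := fun k x =>
    hasFDerivAt_potential (contDiff_logKer (pow_pos (he0 k) 4))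
      (norm_fderiv_logKer_le (pow_pos (he0 k) 4)) hgi
      (fun x => (hdom x).mono' (hmeas k x) (hbd k x)) x
  have hLt : ∀ x, Tendsto (fun k => L k x) atTop
      (𝓝 (-∫ y, log ((‖y‖ + 1) / ‖x - y‖) * g y)) := fun x => by
    rw [← integral_neg]
    refine tendsto_integral_of_dominated_convergence _ (hmeas · x) (hdom x) (hbd · x) ?_
    filter_upwards [ae_ne_point hn0 x] with y hy
    have hd : 0 < ‖x - y‖ := norm_pos_iff.2 (sub_ne_zero.2 hy)
    have h1 : Tendsto (fun k => logKer (e k ^ 4) (x - y)) atTop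
        (𝓝 (1 / 2 * log (‖x - y‖ ^ 2 + 0 ^ 4))) :=
      ((((het.pow 4).const_add _).log (by positivity)).const_mul _)
    have h2 := (h1.sub_const (log (‖y‖ + 1))).mul_const (g y)
    convert h2 using 2
    rw [log_div (by positivity) (by positivity), zero_pow (by norm_num), add_zero, log_pow]
    push_cast
    ring
  have hunif : TendstoUniformlyOn L' (gradPot n μ u) atTop (ball 0 (‖x‖ + 1)) := by
    obtain ⟨M, hM0, hM⟩ := exists_bound_curv hn0 hμ0 hμn hu hB.1 (‖x‖ + 2)
    set K := M * kerMass n (3 / 2) + ∫ y, g y with hK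
    have hbound : ∀ k, ∀ z ∈ ball (0 : Euc n) (‖x‖ + 1),
        ‖gradPot n μ u z - L' k z‖ ≤ e k * K := by
      intro k z hz
      have hi1 := integrable_curv_smul hn hμ0 hμn hu hB z
      have hi2 : Integrable fun y => g y • fderiv ℝ (logKer (e k ^ 4)) (z - y) := by
        refine (hgi.mul_const (1 + (e k ^ 4)⁻¹)).mono' ?_ (ae_of_all _ fun y => ?_)
        · have := (contDiff_logKer (n := n) (pow_pos (he0 k) 4)).continuous_fderiv (by simp)
          exact hgm.smul (by fun_prop : Continuous fun y =>
            fderiv ℝ (logKer (e k ^ 4)) (z - y)).aestronglyMeasurable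
        · rw [norm_smul, Real.norm_of_nonneg (curv_nonneg y)]
          exact mul_le_mul_of_nonneg_left (norm_fderiv_logKer_le (pow_pos (he0 k) 4) _)
            (curv_nonneg y)
      obtain ⟨hi3, hle⟩ := integrable_norm_rpow_neg_mul hn0 (s := 3 / 2) (by norm_num)
        (by linarith) (curv_nonneg (μ := μ) (u := u)) hgi (x := z) (M := M) (fun y hy => hM y (by
          have := norm_le_norm_add_norm_sub' y z
          rw [mem_ball, dist_eq_norm] at hy
          rw [mem_ball_zero_iff] at hz
          linarith))
      rw [gradPot, ← integral_sub hi1 hi2]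
      refine (norm_integral_le_of_norm_le (hi3.const_mul (e k)) ?_).trans ?_
      · filter_upwards [ae_ne_point hn0 z] with y hy
        rw [← smul_sub, norm_smul, Real.norm_of_nonneg (curv_nonneg y), norm_sub_rev,
          fderiv_logKer (pow_pos (he0 k) 4)]
        have := mul_le_mul_of_nonneg_left (norm_gradKer_sub_le (sub_ne_zero.2 hy) (he0 k))
          (curv_nonneg (μ := μ) (u := u) y)
        linarith
      · rw [integral_const_mul]
        exact mul_le_mul_of_nonneg_left hle (he0 k).le
    rw [Metric.tendstoUniformlyOn_iff]
    intro δ hδ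
    have h1 : Tendsto (fun k => e k * K) atTop (𝓝 0) := by simpa using het.mul_const K
    filter_upwards [h1.eventually (gt_mem_nhds hδ)] with k hk z hz
    rw [dist_eq_norm]
    exact (hbound k z hz).trans_lt hk
  have hmain := hasFDerivAt_of_tendstoUniformlyOn isOpen_ball hunif
    (fun k z _ => hLd k z) (fun z _ => hLt z)
    (show x ∈ ball (0 : Euc n) (‖x‖ + 1) by simp)
  have hfin := ((hmain.const_mul (-(1 / betaN n))).add_const C)
  refine hfin.congr_of_eventuallyEq (Eventually.of_forall fun z => ?_)
  rw [hC z]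
  simp only [hg, curv, dens]
  ring

end Gradient

section Pohozaev

variable {n : ℕ}

/-- Integration by parts against the Euler vector field. -/
lemma integral_fderiv_self {F : Euc n → ℝ} (hF : ContDiff ℝ 1 F) (hc : HasCompactSupport F) :
    ∫ x, fderiv ℝ F x x = -n * ∫ x, F x := by
  have hF' := hF.continuous_fderiv one_ne_zero
  have hFi : Integrable F := hF.continuous.integrable_of_hasCompactSupport hc
  let b := EuclideanSpace.basisFun (Fin n) ℝ
  have hcd : HasCompactSupport (fderiv ℝ F) := hc.fderiv ℝ
  have hint : ∀ i, Integrable fun x : Euc n => x i * fderiv ℝ F x (b i) := fun i => by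
    refine Continuous.integrable_of_hasCompactSupport (by fun_prop) ?_
    refine hcd.mono fun x hx => ?_
    contrapose! hx
    simp only [Function.notMem_support] at hx ⊢
    simp [hx]
  have hdiff : ∀ (i : Fin n) (x : Euc n), HasFDerivAt (fun x : Euc n => x i)
      (EuclideanSpace.proj i : Euc n →L[ℝ] ℝ) x := fun i x =>
    (EuclideanSpace.proj i : Euc n →L[ℝ] ℝ).hasFDerivAt
  have hparts : ∀ i, ∫ x : Euc n, x i * fderiv ℝ F x (b i) = -∫ x, F x := fun i => by
    have h1 : ∀ x : Euc n, fderiv ℝ (fun x : Euc n => x i) x (b i) * F x = F x := fun x => by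
      rw [(hdiff i x).fderiv]
      simp [b]
    rw [integral_mul_fderiv_eq_neg_fderiv_mul_of_integrable (f := fun x : Euc n => x i)
      (hfg' := hint i)]
    · simp_rw [h1]
    · simp_rw [h1]
      exact hFi
    · refine Continuous.integrable_of_hasCompactSupport ?_ hc.mul_left
      exact (by fun_prop : Continuous fun x : Euc n => x i).mul hF.continuous
    · exact fun x _ => (hdiff i x).differentiableAt
    · exact fun x _ => hF.differentiable one_ne_zero x
  have hsum : ∀ x : Euc n, fderiv ℝ F x x = ∑ i, x i * fderiv ℝ F x (b i) := fun x => by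
    have h1 := congrArg (fderiv ℝ F x) (b.sum_repr x)
    rw [map_sum] at h1
    simpa [b, EuclideanSpace.basisFun_repr] using h1.symm
  simp_rw [hsum]
  rw [integral_finsetSum _ fun i _ => hint i]
  simp [hparts]

lemma exists_cutoff (n : ℕ) : ∃ (η : ℕ → Euc n → ℝ) (C : ℝ), 0 ≤ C ∧
    (∀ k, ContDiff ℝ 1 (η k)) ∧ (∀ k, HasCompactSupport (η k)) ∧
    (∀ k x, 0 ≤ η k x ∧ η k x ≤ 1) ∧ (∀ k x, |fderiv ℝ (η k) x x| ≤ C) ∧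
    (∀ k x y, ‖η k x • x - η k y • y‖ ≤ C * ‖x - y‖) ∧
    ∀ x, ∀ᶠ k in atTop, η k x = 1 ∧ fderiv ℝ (η k) x x = 0 := by
  let b : ContDiffBump (0 : Euc n) := ⟨1, 2, one_pos, one_lt_two⟩
  have hb : ContDiff ℝ 1 (b : Euc n → ℝ) := b.contDiff
  have hbc : HasCompactSupport (b : Euc n → ℝ) := b.hasCompactSupport
  have hb' := hb.continuous_fderiv one_ne_zero
  obtain ⟨C1, hC1⟩ : ∃ C, ∀ z, ‖fderiv ℝ b z z‖ ≤ C := by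
    refine HasCompactSupport.exists_bound_of_continuous ?_ (by fun_prop)
    refine (hbc.fderiv ℝ).mono fun x hx => ?_
    contrapose! hx
    simp only [Function.notMem_support] at hx ⊢
    simp [hx]
  obtain ⟨C2, hC2⟩ := ContDiff.lipschitzWith_of_hasCompactSupport (𝕂 := ℝ)
    (f := fun x : Euc n => b x • x) hbc.smul_right (hb.smul contDiff_id) one_ne_zero
  let R : ℕ → ℝ := fun k => k + 1
  have hR : ∀ k, 0 < R k := fun k => Nat.cast_add_one_pos k
  have hd : ∀ k x, HasFDerivAt (fun x => b ((R k)⁻¹ • x))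
      ((fderiv ℝ b ((R k)⁻¹ • x)).comp ((R k)⁻¹ • ContinuousLinearMap.id ℝ (Euc n))) x :=
    fun k x => ((hb.differentiable one_ne_zero _).hasFDerivAt).comp x
      ((R k)⁻¹ • ContinuousLinearMap.id ℝ (Euc n)).hasFDerivAt
  have hd' : ∀ k x, fderiv ℝ (fun x => b ((R k)⁻¹ • x)) x x =
      fderiv ℝ b ((R k)⁻¹ • x) ((R k)⁻¹ • x) := fun k x => by
    rw [(hd k x).fderiv]; simp
  refine ⟨fun k x => b ((R k)⁻¹ • x), max C1 C2, le_max_of_le_right C2.2, fun k => ?_, fun k => ?_,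
    fun k x => ⟨b.nonneg, b.le_one⟩, fun k x => ?_, fun k x y => ?_, fun x => ?_⟩
  · exact hb.comp (contDiff_id.const_smul _)
  · exact hbc.comp_smul (inv_ne_zero (hR k).ne')
  · rw [hd']
    exact (hC1 _).trans (le_max_left _ _)
  · have h1 := hC2.dist_le_mul ((R k)⁻¹ • x) ((R k)⁻¹ • y)
    rw [dist_eq_norm, dist_eq_norm, ← smul_sub, smul_comm, smul_comm _ _ y, ← smul_sub, norm_smul,
      norm_smul, mul_left_comm] at h1
    have h2 := le_of_mul_le_mul_left h1 (norm_pos_iff.2 (inv_ne_zero (hR k).ne'))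
    exact h2.trans (mul_le_mul_of_nonneg_right (le_max_right _ _) (norm_nonneg _))
  · have h1 : Tendsto R atTop atTop :=
      tendsto_atTop_add_const_right _ _ tendsto_natCast_atTop_atTop
    filter_upwards [h1.eventually_gt_atTop ‖x‖] with k hk
    have hx : (R k)⁻¹ • x ∈ ball (0 : Euc n) 1 := by
      rw [mem_ball_zero_iff, norm_smul, norm_inv, Real.norm_of_nonneg (hR k).le,
        inv_mul_lt_iff₀ (hR k)]
      linarith
    have h2 := b.eventuallyEq_one_of_mem_ball hx
    refine ⟨h2.self_of_nhds, ?_⟩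
    rw [hd', h2.fderiv_eq]
    simp [Pi.one_def]

lemma integral_prod_symm {Φ : Euc n × Euc n → ℝ} (hΦ : Integrable Φ) :
    ∫ p, Φ p = 1 / 2 * ∫ p : Euc n × Euc n, (Φ p + Φ p.swap) := by
  have h1 : ∫ p : Euc n × Euc n, Φ p.swap = ∫ p, Φ p := by
    rw [Measure.volume_eq_prod, integral_prod_swap]
  have h2 : Integrable fun p : Euc n × Euc n => Φ p.swap := by
    rw [Measure.volume_eq_prod] at hΦ ⊢
    exact hΦ.swap
  rw [integral_add hΦ h2, h1]
  ring

end Pohozaev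

section PohozaevLog

variable {n : ℕ} {μ : ℝ} {u : Euc n → ℝ}

lemma integrable_prod_log (hn : 2 ≤ n) (hμ0 : 0 < μ) (hμn : μ < n) (hu : Continuous u)
    (hB : CondB n μ u) {η : Euc n → ℝ} (hη : Continuous η) (hηc : HasCompactSupport η) :
    Integrable fun p : Euc n × Euc n => η p.1 * ((‖p.1 - p.2‖ ^ 2)⁻¹ * inner ℝ (p.1 - p.2) p.1) *
      (curv n μ u p.1 * curv n μ u p.2) := by
  have hn0 : 0 < n := by lia
  have hn1 : (1 : ℝ) < n := by exact_mod_cast (by lia : 1 < n)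
  have hgm := (stronglyMeasurable_curv (μ := μ) hu).measurable
  have hgi := integrable_curv hB
  have hg0 := curv_nonneg (n := n) (μ := μ) (u := u)
  have hir := integrable_rpow_mul_curv hn0 hμ0 hμn hu hB zero_le_one hn1
  have hbd := exists_bound_curv hn0 hμ0 hμn hu hB.1
  generalize curv n μ u = g at *
  obtain ⟨R, hR0, hR⟩ : ∃ R, 0 ≤ R ∧ ∀ x, η x ≠ 0 → ‖x‖ ≤ R := by
    obtain ⟨R, hR⟩ := hηc.isCompact.isBounded.subset_closedBall (0 : Euc n)
    exact ⟨max R 0, le_max_right _ _, fun x hx => le_max_of_le_left <| by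
      simpa using hR (subset_tsupport _ hx)⟩
  obtain ⟨E, hE⟩ := hηc.exists_bound_of_continuous hη
  obtain ⟨M, hM0, hM⟩ := hbd (R + 1)
  have hI0 : 0 ≤ ∫ y, g y := integral_nonneg hg0
  have hE0 : 0 ≤ E := (norm_nonneg _).trans (hE 0)
  have hmeas : Measurable (fun p : Euc n × Euc n =>
      η p.1 * ((‖p.1 - p.2‖ ^ 2)⁻¹ * inner ℝ (p.1 - p.2) p.1) * (g p.1 * g p.2)) := by
    have h2 := hη.measurable
    fun_prop
  have hle : ∀ x y : Euc n, ‖η x * ((‖x - y‖ ^ 2)⁻¹ * inner ℝ (x - y) x) * (g x * g y)‖ ≤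
      |η x| * ‖x‖ * g x * (‖x - y‖ ^ (-1 : ℝ) * g y) := fun x y => by
    have h1 : ‖(‖x - y‖ ^ 2)⁻¹ * inner ℝ (x - y) x‖ ≤ ‖x - y‖ ^ (-1 : ℝ) * ‖x‖ := by
      rw [norm_mul, norm_inv, norm_pow, norm_norm, Real.rpow_neg_one]
      rcases eq_or_ne ‖x - y‖ 0 with h | h
      · simp [h]
      · calc (‖x - y‖ ^ 2)⁻¹ * ‖(inner ℝ (x - y) x : ℝ)‖ ≤ (‖x - y‖ ^ 2)⁻¹ * (‖x - y‖ * ‖x‖) := by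
              gcongr; exact norm_inner_le_norm _ _
          _ = ‖x - y‖⁻¹ * ‖x‖ := by field_simp
    rw [norm_mul, norm_mul, norm_mul (g x), Real.norm_of_nonneg (hg0 x),
      Real.norm_of_nonneg (hg0 y), Real.norm_eq_abs (η x)]
    have hx0 := hg0 x
    have hy0 := hg0 y
    calc |η x| * ‖(‖x - y‖ ^ 2)⁻¹ * inner ℝ (x - y) x‖ * (g x * g y)
        ≤ |η x| * (‖x - y‖ ^ (-1 : ℝ) * ‖x‖) * (g x * g y) := by gcongr
      _ = _ := by ring
  have hiy : ∀ x : Euc n, Integrable fun y =>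
      |η x| * ‖x‖ * g x * (‖x - y‖ ^ (-1 : ℝ) * g y) := fun x => (hir x).const_mul _
  have hsec : ∀ x : Euc n, Integrable fun y => η x * ((‖x - y‖ ^ 2)⁻¹ * inner ℝ (x - y) x) *
      (g x * g y) := fun x =>
    (hiy x).mono' (hmeas.comp measurable_prodMk_left).aestronglyMeasurable (ae_of_all _ (hle x))
  rw [Measure.volume_eq_prod, integrable_prod_iff hmeas.aestronglyMeasurable]
  refine ⟨ae_of_all _ hsec, ?_⟩
  refine (hgi.const_mul (E * R * (M * kerMass n 1 + ∫ y, g y))).mono'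
    hmeas.aestronglyMeasurable.norm.integral_prod_right' (ae_of_all _ fun x => ?_)
  rw [Real.norm_of_nonneg (integral_nonneg fun y => norm_nonneg _)]
  refine (integral_mono (hsec x).norm (hiy x) (hle x)).trans ?_
  rw [integral_const_mul]
  have h2 := hg0 x
  have hk := kerMass_nonneg n 1
  by_cases hx : η x = 0
  · rw [hx, abs_zero, zero_mul, zero_mul, zero_mul]
    positivity
  have hxR := hR x hx
  have hb := (integrable_norm_rpow_neg_mul hn0 zero_le_one hn1 hg0 hgi (x := x) (M := M)
    fun y hy => hM y (by
      have := norm_le_norm_add_norm_sub' y x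
      rw [mem_ball, dist_eq_norm] at hy
      linarith)).2
  have h1 := hE x
  rw [Real.norm_eq_abs] at h1
  have hi0 : 0 ≤ ∫ y, ‖x - y‖ ^ (-1 : ℝ) * g y :=
    integral_nonneg fun y => mul_nonneg (by positivity) (hg0 y)
  calc |η x| * ‖x‖ * g x * ∫ y, ‖x - y‖ ^ (-1 : ℝ) * g y
      ≤ E * R * g x * (M * kerMass n 1 + ∫ y, g y) := by gcongr
    _ = _ := by ring

lemma integral_fderiv_mul_curv (hn : 2 ≤ n) (hμ0 : 0 < μ) (hμn : μ < n) (hu : Continuous u)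
    (hB : CondB n μ u) (hIE : IE n μ u) {η : Euc n → ℝ} (hη : Continuous η)
    (hηc : HasCompactSupport η) :
    ∫ x, η x * fderiv ℝ u x x * curv n μ u x = -(1 / (2 * betaN n)) *
      ∫ p : Euc n × Euc n, (‖p.1 - p.2‖ ^ 2)⁻¹ *
        inner ℝ (η p.1 • p.1 - η p.2 • p.2) (p.1 - p.2) * (curv n μ u p.1 * curv n μ u p.2) := by
  have hΦ := integrable_prod_log hn hμ0 hμn hu hB hη hηc
  have h1 : ∀ x, η x * fderiv ℝ u x x * curv n μ u x = -(1 / betaN n) *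
      ∫ y, η x * ((‖x - y‖ ^ 2)⁻¹ * inner ℝ (x - y) x) * (curv n μ u x * curv n μ u y) := by
    intro x
    rw [(hasFDerivAt_of_IE hn hμ0 hμn hu hB hIE x).fderiv, gradPot, smul_apply,
      ContinuousLinearMap.integral_apply (integrable_curv_smul hn hμ0 hμn hu hB x),
      smul_eq_mul]
    calc _ = -(1 / betaN n) * (η x * curv n μ u x *
          ∫ y, (curv n μ u y • (‖x - y‖ ^ 2)⁻¹ • innerSL ℝ (x - y)) x) := by ring
      _ = _ := by
        rw [← integral_const_mul]
        congr 2
        ext y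
        simp only [smul_apply, smul_eq_mul, innerSL_apply_apply]
        ring
  simp_rw [h1]
  rw [integral_const_mul, ← integral_prod (f := fun p : Euc n × Euc n => η p.1 *
    ((‖p.1 - p.2‖ ^ 2)⁻¹ * inner ℝ (p.1 - p.2) p.1) * (curv n μ u p.1 * curv n μ u p.2))
    (by rwa [Measure.volume_eq_prod] at hΦ), ← Measure.volume_eq_prod, integral_prod_symm hΦ]
  have h2 : ∀ p : Euc n × Euc n, η p.1 *
    ((‖p.1 - p.2‖ ^ 2)⁻¹ * inner ℝ (p.1 - p.2) p.1) * (curv n μ u p.1 * curv n μ u p.2) +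
    η p.swap.1 * ((‖p.swap.1 - p.swap.2‖ ^ 2)⁻¹ * inner ℝ (p.swap.1 - p.swap.2) p.swap.1) *
      (curv n μ u p.swap.1 * curv n μ u p.swap.2) = (‖p.1 - p.2‖ ^ 2)⁻¹ *
        inner ℝ (η p.1 • p.1 - η p.2 • p.2) (p.1 - p.2) * (curv n μ u p.1 * curv n μ u p.2) := by
    intro p
    rw [Prod.fst_swap, Prod.snd_swap, norm_sub_rev p.2 p.1, inner_sub_left (η p.1 • p.1),
      real_inner_smul_left, real_inner_smul_left, ← neg_sub p.1 p.2, inner_neg_left,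
      real_inner_comm p.1, real_inner_comm p.2]
    ring
  simp_rw [h2]
  field_simp

end PohozaevLog

section PohozaevRiesz

variable {n : ℕ} {μ : ℝ} {u : Euc n → ℝ}

lemma exists_bound_mul_norm {η : Euc n → ℝ} (hη : Continuous η) (hηc : HasCompactSupport η) :
    ∃ E, ∀ x, |η x| * ‖x‖ ≤ E := by
  obtain ⟨E, hE⟩ := (hηc.smul_right (f' := fun x : Euc n => x)).exists_bound_of_continuous
    (by fun_prop)
  exact ⟨E, fun x => by simpa [norm_smul] using hE x⟩

lemma rieszKer_pos {e : ℝ} (he : 0 < e) (z : Euc n) : 0 < rieszKer μ e z := by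
  unfold rieszKer; positivity

lemma rieszKer_le (hμ : 0 < μ) {e : ℝ} (he : 0 < e) (z : Euc n) :
    rieszKer μ e z ≤ e ^ (-μ / 2) :=
  Real.rpow_le_rpow_of_nonpos he (by nlinarith [sq_nonneg ‖z‖]) (by linarith)

lemma integrable_rieszKer_mul (hμ : 0 < μ) {e : ℝ} (he : 0 < e) {f : Euc n → ℝ}
    (hf : Integrable f) (x : Euc n) : Integrable fun y => (rieszKer μ e (x - y) - 0) * f y := by
  have hc := (contDiff_rieszKer (n := n) μ he).continuous
  refine hf.bdd_mul (c := e ^ (-μ / 2))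
    (by fun_prop : Continuous fun y => rieszKer μ e (x - y) - 0).aestronglyMeasurable
    (ae_of_all _ fun y => ?_)
  rw [sub_zero, Real.norm_of_nonneg (rieszKer_pos he _).le]
  exact rieszKer_le hμ he _

lemma integral_prod_fderiv_rieszKer (hμ : 0 < μ) {f : Euc n → ℝ} (hfc : Continuous f)
    (hf : Integrable f) {η : Euc n → ℝ} (hη : Continuous η) (hηc : HasCompactSupport η)
    {e : ℝ} (he : 0 < e) :
    ∫ x, η x * f x * (∫ y, f y • fderiv ℝ (rieszKer μ e) (x - y)) x = -(μ / 2) *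
      ∫ p : Euc n × Euc n, (‖p.1 - p.2‖ ^ 2 + e) ^ (-μ / 2 - 1) *
        inner ℝ (η p.1 • p.1 - η p.2 • p.2) (p.1 - p.2) * (f p.1 * f p.2) := by
  have hk := contDiff_rieszKer (n := n) μ he
  have hk' := hk.continuous_fderiv one_ne_zero
  have hB := norm_fderiv_rieszKer_le (n := n) hμ he
  obtain ⟨E, hE⟩ := exists_bound_mul_norm hη hηc
  set B := μ * e ^ (-μ / 2) * (1 + e⁻¹)
  have hB0 : 0 ≤ B := (norm_nonneg _).trans (hB 0)
  have hΦ : Integrable fun p : Euc n × Euc n =>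
      η p.1 * fderiv ℝ (rieszKer μ e) (p.1 - p.2) p.1 * (f p.1 * f p.2) := by
    refine (hf.mul_prod hf).bdd_mul (c := B * E)
      (by fun_prop : Continuous fun p : Euc n × Euc n =>
        η p.1 * fderiv ℝ (rieszKer μ e) (p.1 - p.2) p.1).aestronglyMeasurable
      (ae_of_all _ fun p => ?_)
    rw [norm_mul, Real.norm_eq_abs (η p.1)]
    calc |η p.1| * ‖fderiv ℝ (rieszKer μ e) (p.1 - p.2) p.1‖
        ≤ |η p.1| * (B * ‖p.1‖) := by
          gcongr
          exact (ContinuousLinearMap.le_opNorm _ _).trans (by gcongr; exact hB _)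
      _ = B * (|η p.1| * ‖p.1‖) := by ring
      _ ≤ B * E := by gcongr; exact hE _
  have h1 : ∀ x, η x * f x * (∫ y, f y • fderiv ℝ (rieszKer μ e) (x - y)) x =
      ∫ y, η x * fderiv ℝ (rieszKer μ e) (x - y) x * (f x * f y) := fun x => by
    rw [ContinuousLinearMap.integral_apply, ← integral_const_mul]
    · congr 1
      ext y
      rw [smul_apply, smul_eq_mul]
      ring
    · refine (hf.norm.mul_const B).mono'
        (by fun_prop :
          Continuous fun y => f y • fderiv ℝ (rieszKer μ e) (x - y)).aestronglyMeasurable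
        (ae_of_all _ fun y => ?_)
      rw [norm_smul]
      gcongr
      exact hB _
  simp_rw [h1]
  rw [← integral_prod (f := fun p : Euc n × Euc n =>
      η p.1 * fderiv ℝ (rieszKer μ e) (p.1 - p.2) p.1 * (f p.1 * f p.2))
      (by rwa [Measure.volume_eq_prod] at hΦ), ← Measure.volume_eq_prod, integral_prod_symm hΦ]
  have h2 : ∀ p : Euc n × Euc n,
      η p.1 * fderiv ℝ (rieszKer μ e) (p.1 - p.2) p.1 * (f p.1 * f p.2) +
      η p.swap.1 * fderiv ℝ (rieszKer μ e) (p.swap.1 - p.swap.2) p.swap.1 *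
        (f p.swap.1 * f p.swap.2) = -μ * ((‖p.1 - p.2‖ ^ 2 + e) ^ (-μ / 2 - 1) *
        inner ℝ (η p.1 • p.1 - η p.2 • p.2) (p.1 - p.2) * (f p.1 * f p.2)) := by
    intro p
    rw [fderiv_rieszKer μ he, fderiv_rieszKer μ he, smul_apply, smul_apply, innerSL_apply_apply,
      innerSL_apply_apply, Prod.fst_swap, Prod.snd_swap, norm_sub_rev p.2 p.1,
      inner_sub_left (η p.1 • p.1),
      real_inner_smul_left, real_inner_smul_left, ← neg_sub p.1 p.2, inner_neg_left,
      real_inner_comm p.1, real_inner_comm p.2, smul_eq_mul, smul_eq_mul]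
    ring
  simp_rw [h2]
  rw [integral_const_mul]
  ring

lemma fderiv_dens (hu : ContDiff ℝ 1 u) (x : Euc n) :
    fderiv ℝ (dens n μ u) x = ((2 * n - μ) / 2 * dens n μ u x) • fderiv ℝ u x := by
  have h := (((hu.differentiable one_ne_zero x).hasFDerivAt.const_mul ((2 * n - μ) / 2)).exp).fderiv
  refine h.trans ?_
  ext w
  simp [dens]
  ring

lemma contDiff_dens (hu : ContDiff ℝ 1 u) : ContDiff ℝ 1 (dens n μ u) := by
  unfold dens; fun_prop

/-- The factor produced by differentiating `η * dens` along the Euler field. -/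
def eulerFactor (n : ℕ) (μ : ℝ) (u η : Euc n → ℝ) (x : Euc n) : ℝ :=
  fderiv ℝ η x x + (2 * n - μ) / 2 * (η x * fderiv ℝ u x x) + n * η x

lemma continuous_eulerFactor (hu : ContDiff ℝ 1 u) {η : Euc n → ℝ} (hη : ContDiff ℝ 1 η) :
    Continuous (eulerFactor n μ u η) := by
  have h1 := hu.continuous_fderiv one_ne_zero
  have h2 := hη.continuous_fderiv one_ne_zero
  have h3 := hη.continuous
  unfold eulerFactor
  fun_prop

lemma hasCompactSupport_eulerFactor {η : Euc n → ℝ} (hηc : HasCompactSupport η) :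
    HasCompactSupport (eulerFactor n μ u η) := by
  refine HasCompactSupport.add (HasCompactSupport.add ?_ ?_) hηc.mul_left
  · refine (hηc.fderiv ℝ).mono fun x hx => ?_
    contrapose! hx
    simp only [Function.notMem_support] at hx ⊢
    simp [hx]
  · exact HasCompactSupport.mul_left hηc.mul_right

lemma integral_eulerFactor_rieszKer (hμ : 0 < μ) (hu : ContDiff ℝ 1 u)
    (hf : Integrable (dens n μ u)) {η : Euc n → ℝ} (hη : ContDiff ℝ 1 η)
    (hηc : HasCompactSupport η) {e : ℝ} (he : 0 < e) :
    ∫ x, eulerFactor n μ u η x * dens n μ u x * ∫ y, (rieszKer μ e (x - y) - 0) * dens n μ u y =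
      μ / 2 * ∫ p : Euc n × Euc n, (‖p.1 - p.2‖ ^ 2 + e) ^ (-μ / 2 - 1) *
        inner ℝ (η p.1 • p.1 - η p.2 • p.2) (p.1 - p.2) * (dens n μ u p.1 * dens n μ u p.2) := by
  have hk := contDiff_rieszKer (n := n) μ he
  have hBd := norm_fderiv_rieszKer_le (n := n) hμ he
  have hfd := fderiv_dens (μ := μ) hu
  have hfC := contDiff_dens (μ := μ) hu
  have hsymm := integral_prod_fderiv_rieszKer hμ hfC.continuous hf hη.continuous hηc he
  have hvd := hasFDerivAt_potential (c := fun _ => 0) hk hBd hf (integrable_rieszKer_mul hμ he hf)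
  have hvc := continuous_fderiv_potential hk hBd hf
  have hq := continuous_eulerFactor (μ := μ) hu hη
  have hqc := hasCompactSupport_eulerFactor (μ := μ) (u := u) hηc
  have hqd : ∀ x, eulerFactor n μ u η x * dens n μ u x =
      η x * fderiv ℝ (dens n μ u) x x + fderiv ℝ η x x * dens n μ u x
        + n * (η x * dens n μ u x) := fun x => by
    rw [hfd, eulerFactor, smul_apply, smul_eq_mul]
    ring
  generalize dens n μ u = f at *
  set v : Euc n → ℝ := fun x => ∫ y, (rieszKer μ e (x - y) - 0) * f y
  set dv : Euc n → Euc n →L[ℝ] ℝ := fun x => ∫ y, f y • fderiv ℝ (rieszKer μ e) (x - y)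
  have hv : ContDiff ℝ 1 v := contDiff_one_iff_hasFDerivAt.2 ⟨dv, hvc, hvd⟩
  have hF : ContDiff ℝ 1 fun x => η x * f x * v x := (hη.mul hfC).mul hv
  have hFc : HasCompactSupport fun x => η x * f x * v x := (hηc.mul_right).mul_right
  have hmain := integral_fderiv_self hF hFc
  have hFd : ∀ x, fderiv ℝ (fun x => η x * f x * v x) x x =
      eulerFactor n μ u η x * f x * v x + η x * f x * dv x x - n * (η x * f x * v x) := fun x => by
    have h := (((hη.differentiable one_ne_zero x).hasFDerivAt.mul
      (hfC.differentiable one_ne_zero x).hasFDerivAt).mul (hvd x)).fderiv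
    have h2 := congrArg (fun L => L x) h
    refine h2.trans ?_
    simp only [add_apply, smul_apply, smul_eq_mul, Pi.mul_apply]
    rw [hqd]
    change η x * f x * dv x x + _ = _
    ring
  simp_rw [hFd] at hmain
  have hi1 : Integrable fun x => eulerFactor n μ u η x * f x * v x :=
    ((hq.mul hfC.continuous).mul hv.continuous).integrable_of_hasCompactSupport
      (hqc.mul_right).mul_right
  have hi2 : Integrable fun x => η x * f x * dv x x := by
    have h1 := hη.continuous
    have h2 := hfC.continuous
    exact Continuous.integrable_of_hasCompactSupport (by fun_prop) (hηc.mul_right).mul_right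
  have hi3 : Integrable fun x => n * (η x * f x * v x) :=
    (hF.continuous.integrable_of_hasCompactSupport hFc).const_mul _
  have hi12 : Integrable fun x => eulerFactor n μ u η x * f x * v x + η x * f x * dv x x :=
    hi1.add hi2
  rw [integral_sub hi12 hi3, integral_add hi1 hi2, integral_const_mul, hsymm] at hmain
  linarith

end PohozaevRiesz

section PohozaevLimit

variable {n : ℕ} {μ : ℝ} {u : Euc n → ℝ}

lemma sq_rpow_half {x : ℝ} (hx : 0 ≤ x) (s : ℝ) : (x ^ 2) ^ (s / 2) = x ^ s := by
  rw [← Real.rpow_natCast, ← Real.rpow_mul hx]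
  congr 1
  push_cast
  ring

lemma rieszKer_le_rpow (hμ : 0 < μ) {e : ℝ} (he : 0 < e) {z : Euc n} (hz : z ≠ 0) :
    rieszKer μ e z ≤ ‖z‖ ^ (-μ) := by
  have hz0 : 0 < ‖z‖ := norm_pos_iff.2 hz
  rw [← sq_rpow_half hz0.le]
  exact Real.rpow_le_rpow_of_nonpos (by positivity) (by linarith) (by linarith)

lemma tendsto_sq_add_rpow {t : ℝ} (ht : t ≠ 0) (s : ℝ) :
    Tendsto (fun e : ℝ => (t ^ 2 + e) ^ s) (𝓝[>] 0) (𝓝 ((t ^ 2) ^ s)) := by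
  have h : ContinuousAt (fun e : ℝ => (t ^ 2 + e) ^ s) 0 :=
    ContinuousAt.rpow_const (by fun_prop) (Or.inl (by rw [add_zero]; positivity))
  have h2 := h.tendsto
  rw [add_zero] at h2
  exact h2.mono_left nhdsWithin_le_nhds

lemma abs_inner_kernel_le {η : Euc n → ℝ} {C : ℝ} (hC : 0 ≤ C)
    (hL : ∀ x y, ‖η x • x - η y • y‖ ≤ C * ‖x - y‖) (hμ : 0 < μ) {e : ℝ} (he : 0 ≤ e)
    (x y : Euc n) :
    |(‖x - y‖ ^ 2 + e) ^ (-μ / 2 - 1) * inner ℝ (η x • x - η y • y) (x - y)| ≤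
      C * ‖x - y‖ ^ (-μ) := by
  rcases eq_or_ne x y with rfl | h
  · simp only [sub_self, inner_zero_right, mul_zero, abs_zero]
    positivity
  have hd : 0 < ‖x - y‖ := norm_pos_iff.2 (sub_ne_zero.2 h)
  have h1 : (‖x - y‖ ^ 2 + e) ^ (-μ / 2 - 1) ≤ (‖x - y‖ ^ 2) ^ (-μ / 2 - 1) :=
    Real.rpow_le_rpow_of_nonpos (by positivity) (by linarith) (by linarith)
  have h2 : |inner ℝ (η x • x - η y • y) (x - y)| ≤ C * ‖x - y‖ ^ 2 := by
    refine (abs_real_inner_le_norm _ _).trans ?_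
    have := hL x y
    calc _ ≤ (C * ‖x - y‖) * ‖x - y‖ := by gcongr
      _ = _ := by ring
  rw [abs_mul, abs_of_nonneg (by positivity), ← sq_rpow_half hd.le]
  calc _ ≤ (‖x - y‖ ^ 2) ^ (-μ / 2 - 1) * (C * ‖x - y‖ ^ 2) := by gcongr
    _ = C * (‖x - y‖ ^ 2) ^ (-μ / 2) := by
      rw [Real.rpow_sub_one (by positivity)]
      field_simp

lemma tendsto_rieszKer_potential (hn : 0 < n) (hμ0 : 0 < μ) (hμn : μ < n) (hu : Continuous u)
    (hf : Integrable (dens n μ u)) (x : Euc n) :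
    Tendsto (fun e => ∫ y, (rieszKer μ e (x - y) - 0) * dens n μ u y) (𝓝[>] 0)
      (𝓝 (V n μ u x)) := by
  rw [V_eq]
  refine tendsto_integral_filter_of_dominated_convergence
    (fun y => ‖x - y‖ ^ (-μ) * dens n μ u y) ?_ ?_ (integrable_rpow_mul_dens hn hμ0 hμn hu hf x) ?_
  · filter_upwards [self_mem_nhdsWithin] with e he
    exact (integrable_rieszKer_mul hμ0 he hf x).aestronglyMeasurable
  · filter_upwards [self_mem_nhdsWithin] with e he
    filter_upwards [ae_ne_point hn x] with y hy
    rw [norm_mul, Real.norm_of_nonneg (dens_pos y).le, sub_zero,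
      Real.norm_of_nonneg (rieszKer_pos he _).le]
    exact mul_le_mul_of_nonneg_right (rieszKer_le_rpow hμ0 he (sub_ne_zero.2 hy)) (dens_pos y).le
  · filter_upwards [ae_ne_point hn x] with y hy
    have hd : 0 < ‖x - y‖ := norm_pos_iff.2 (sub_ne_zero.2 hy)
    simp only [sub_zero]
    rw [← sq_rpow_half hd.le]
    exact (tendsto_sq_add_rpow hd.ne' _).mul_const _

lemma rieszKer_potential_le (hn : 0 < n) (hμ0 : 0 < μ) (hμn : μ < n) (hu : Continuous u)
    (hf : Integrable (dens n μ u)) (x : Euc n) {e : ℝ} (he : 0 < e) :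
    ∫ y, (rieszKer μ e (x - y) - 0) * dens n μ u y ≤ V n μ u x := by
  rw [V_eq]
  refine integral_mono_ae (integrable_rieszKer_mul hμ0 he hf x)
    (integrable_rpow_mul_dens hn hμ0 hμn hu hf x) ?_
  filter_upwards [ae_ne_point hn x] with y hy
  rw [sub_zero]
  exact mul_le_mul_of_nonneg_right (rieszKer_le_rpow hμ0 he (sub_ne_zero.2 hy)) (dens_pos y).le

lemma integral_eulerFactor_curv (hn : 0 < n) (hμ0 : 0 < μ) (hμn : μ < n) (hu : ContDiff ℝ 1 u)
    (hB : CondB n μ u) {η : Euc n → ℝ} (hη : ContDiff ℝ 1 η) (hηc : HasCompactSupport η)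
    {C : ℝ} (hC : 0 ≤ C) (hL : ∀ x y, ‖η x • x - η y • y‖ ≤ C * ‖x - y‖) :
    ∫ x, eulerFactor n μ u η x * curv n μ u x =
      μ / 2 * ∫ p : Euc n × Euc n, (‖p.1 - p.2‖ ^ 2) ^ (-μ / 2 - 1) *
        inner ℝ (η p.1 • p.1 - η p.2 • p.2) (p.1 - p.2) * (dens n μ u p.1 * dens n μ u p.2) := by
  have huc := hu.continuous
  have hq := continuous_eulerFactor (μ := μ) hu hη
  obtain ⟨E, hE⟩ := (hasCompactSupport_eulerFactor (μ := μ) (u := u)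
    hηc).exists_bound_of_continuous hq
  have hk : ∀ {e : ℝ}, 0 < e → Continuous fun x => ∫ y, (rieszKer μ e (x - y) - 0) * dens n μ u y :=
    fun {e} he => continuous_iff_continuousAt.2 fun x =>
      (hasFDerivAt_potential (c := fun _ => 0) (contDiff_rieszKer (n := n) μ he)
        (norm_fderiv_rieszKer_le hμ0 he) hB.1 (integrable_rieszKer_mul hμ0 he hB.1) x).continuousAt
  have hdc := continuous_dens (μ := μ) huc
  have hl : Tendsto (fun e => ∫ x, eulerFactor n μ u η x * dens n μ u x *
      ∫ y, (rieszKer μ e (x - y) - 0) * dens n μ u y) (𝓝[>] 0)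
      (𝓝 (∫ x, eulerFactor n μ u η x * curv n μ u x)) := by
    refine tendsto_integral_filter_of_dominated_convergence (fun x => E * curv n μ u x) ?_ ?_
      ((integrable_curv hB).const_mul E) ?_
    · filter_upwards [self_mem_nhdsWithin] with e he
      have := hk he
      exact ((hq.mul hdc).mul this).aestronglyMeasurable
    · filter_upwards [self_mem_nhdsWithin] with e he
      refine ae_of_all _ fun x => ?_
      have h0 : 0 ≤ ∫ y, (rieszKer μ e (x - y) - 0) * dens n μ u y :=
        integral_nonneg fun y => by
          rw [sub_zero]; exact mul_nonneg (rieszKer_pos he _).le (dens_pos y).le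
      have h1 := rieszKer_potential_le hn hμ0 hμn huc hB.1 x he
      have h2 := hE x
      have h3 := dens_pos (n := n) (μ := μ) (u := u) x
      rw [norm_mul, norm_mul, Real.norm_of_nonneg h3.le, Real.norm_of_nonneg h0, curv]
      have hE0 := (norm_nonneg _).trans h2
      calc _ ≤ E * dens n μ u x * V n μ u x := by gcongr
        _ = _ := by ring
    · refine ae_of_all _ fun x => ?_
      have := (tendsto_rieszKer_potential hn hμ0 hμn huc hB.1 x).const_mul
        (eulerFactor n μ u η x * dens n μ u x)
      convert this using 2
      rw [curv]
      ring
  have hr : Tendsto (fun e => μ / 2 * ∫ p : Euc n × Euc n, (‖p.1 - p.2‖ ^ 2 + e) ^ (-μ / 2 - 1) *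
        inner ℝ (η p.1 • p.1 - η p.2 • p.2) (p.1 - p.2) * (dens n μ u p.1 * dens n μ u p.2))
      (𝓝[>] 0) (𝓝 (μ / 2 * ∫ p : Euc n × Euc n, (‖p.1 - p.2‖ ^ 2) ^ (-μ / 2 - 1) *
        inner ℝ (η p.1 • p.1 - η p.2 • p.2) (p.1 - p.2) *
          (dens n μ u p.1 * dens n μ u p.2))) := by
    refine Tendsto.const_mul _ ?_
    have hd0 := fun y => dens_pos (n := n) (μ := μ) (u := u) y
    have hp := integrable_prod_dens hB
    have hηm := hη.continuous.measurable
    have hdm := hdc.measurable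
    generalize dens n μ u = f at *
    refine tendsto_integral_filter_of_dominated_convergence
      (fun p => C * (‖p.1 - p.2‖ ^ (-μ) * (f p.1 * f p.2))) ?_ ?_ (hp.const_mul C) ?_
    · refine Eventually.of_forall fun e => Measurable.aestronglyMeasurable ?_
      fun_prop
    · filter_upwards [self_mem_nhdsWithin] with e he
      refine ae_of_all _ fun p => ?_
      rw [norm_mul, Real.norm_of_nonneg (mul_pos (hd0 _) (hd0 _)).le, ← mul_assoc C]
      exact mul_le_mul_of_nonneg_right (abs_inner_kernel_le hC hL hμ0 (le_of_lt he) _ _)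
        (mul_pos (hd0 _) (hd0 _)).le
    · refine ae_of_all _ fun p => Tendsto.mul_const _ ?_
      rcases eq_or_ne ‖p.1 - p.2‖ 0 with h | h
      · rw [norm_eq_zero] at h
        simp [h]
      · exact (tendsto_sq_add_rpow h _).mul_const _
  refine tendsto_nhds_unique (hl.congr' ?_) hr
  filter_upwards [self_mem_nhdsWithin] with e he
  exact integral_eulerFactor_rieszKer hμ0 hu hB.1 hη hηc he

lemma integral_curv_pos (hn : 0 < n) (hμ0 : 0 < μ) (hμn : μ < n) (hu : Continuous u)
    (hB : CondB n μ u) : 0 < ∫ x, curv n μ u x := by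
  rw [integral_pos_iff_support_of_nonneg curv_nonneg (integrable_curv hB)]
  have : Function.support (curv n μ u) = Set.univ := by
    ext x
    exact iff_of_true (mul_pos (V_pos hn hμ0 hμn hu hB.1 x) (dens_pos x)).ne' trivial
  rw [this]
  exact isOpen_univ.measure_pos volume ⟨0, trivial⟩

/-- The Pohozaev identity determines the total curvature. -/
theorem integral_curv_eq (hn : 2 ≤ n) (hμ0 : 0 < μ) (hμn : μ < n) (hu : ContDiff ℝ 1 u)
    (hB : CondB n μ u) (hIE : IE n μ u) : ∫ x, curv n μ u x = 2 * betaN n := by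
  have hn0 : 0 < n := by lia
  have hβ := betaN_pos n hn0
  have huc := hu.continuous
  have hgi := integrable_curv hB
  have hgm := (stronglyMeasurable_curv (μ := μ) huc)
  have hSpos := integral_curv_pos hn0 hμ0 hμn huc hB
  obtain ⟨η, C, hC, hη, hηc, hη01, hηD, hηL, hηlim⟩ := exists_cutoff n
  have hηc' := fun k => (hη k).continuous
  have hηX : ∀ x y, ∀ᶠ k in atTop, η k x • x - η k y • y = x - y := fun x y => by
    filter_upwards [hηlim x, hηlim y] with k h1 h2
    rw [h1.1, h2.1, one_smul, one_smul]
  have hPlog := fun k => integral_fderiv_mul_curv hn hμ0 hμn huc hB hIE (hηc' k) (hηc k)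
  have hPr := fun k => integral_eulerFactor_curv hn0 hμ0 hμn hu hB (hη k) (hηc k) hC (hηL k)
  have hcomb : ∀ k, ∫ x, (fderiv ℝ (η k) x x + n * η k x) * curv n μ u x =
      μ / 2 * (∫ p : Euc n × Euc n, (‖p.1 - p.2‖ ^ 2) ^ (-μ / 2 - 1) *
        inner ℝ (η k p.1 • p.1 - η k p.2 • p.2) (p.1 - p.2) * (dens n μ u p.1 * dens n μ u p.2)) +
      (2 * n - μ) / 2 * ((1 / (2 * betaN n)) * ∫ p : Euc n × Euc n, (‖p.1 - p.2‖ ^ 2)⁻¹ *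
        inner ℝ (η k p.1 • p.1 - η k p.2 • p.2) (p.1 - p.2) *
          (curv n μ u p.1 * curv n μ u p.2)) := fun k => by
    have hc1 : Continuous fun x => η k x * fderiv ℝ u x x := by
      have := hu.continuous_fderiv one_ne_zero
      have := hηc' k
      fun_prop
    obtain ⟨E, hE⟩ := (hηc k).mul_right (f' := fun x => fderiv ℝ u x x)
      |>.exists_bound_of_continuous hc1
    obtain ⟨E', hE'⟩ := (hasCompactSupport_eulerFactor (μ := μ) (u := u)
      (hηc k)).exists_bound_of_continuous (continuous_eulerFactor hu (hη k))
    have hi1 : Integrable fun x => η k x * fderiv ℝ u x x * curv n μ u x :=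
      hgi.bdd_mul hc1.aestronglyMeasurable (ae_of_all _ hE)
    have hi2 : Integrable fun x => eulerFactor n μ u (η k) x * curv n μ u x :=
      hgi.bdd_mul (continuous_eulerFactor hu (hη k)).aestronglyMeasurable (ae_of_all _ hE')
    have h1 := hPlog k
    rw [← hPr k]
    have h2 : ∫ x, (fderiv ℝ (η k) x x + n * η k x) * curv n μ u x =
        (∫ x, eulerFactor n μ u (η k) x * curv n μ u x) -
          (2 * n - μ) / 2 * ∫ x, η k x * fderiv ℝ u x x * curv n μ u x := by
      rw [← integral_const_mul, ← integral_sub hi2 (hi1.const_mul _)]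
      congr 1
      ext x
      rw [eulerFactor]
      ring
    rw [h2, h1]
    ring
  have hl : Tendsto (fun k => ∫ x, (fderiv ℝ (η k) x x + n * η k x) * curv n μ u x) atTop
      (𝓝 (n * ∫ x, curv n μ u x)) := by
    rw [← integral_const_mul]
    refine tendsto_integral_of_dominated_convergence (fun x => (C + n) * curv n μ u x)
      (fun k => ?_) (hgi.const_mul _) (fun k => ae_of_all _ fun x => ?_) (ae_of_all _ fun x => ?_)
    · have h1 := (hη k).continuous_fderiv one_ne_zero
      have h2 := hηc' k
      exact (by fun_prop :
        Continuous fun x => fderiv ℝ (η k) x x + n * η k x).aestronglyMeasurable.mul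
        hgm.aestronglyMeasurable
    · rw [norm_mul, Real.norm_of_nonneg (curv_nonneg x)]
      refine mul_le_mul_of_nonneg_right ((norm_add_le _ _).trans (add_le_add (hηD k x) ?_))
        (curv_nonneg x)
      rw [Real.norm_of_nonneg (mul_nonneg n.cast_nonneg (hη01 k x).1)]
      exact mul_le_of_le_one_right n.cast_nonneg (hη01 k x).2
    · refine tendsto_const_nhds.congr' ?_
      filter_upwards [hηlim x] with k hk
      rw [hk.1, hk.2]
      ring
  have hr1 : Tendsto (fun k => ∫ p : Euc n × Euc n, (‖p.1 - p.2‖ ^ 2) ^ (-μ / 2 - 1) *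
        inner ℝ (η k p.1 • p.1 - η k p.2 • p.2) (p.1 - p.2) * (dens n μ u p.1 * dens n μ u p.2))
      atTop (𝓝 (∫ x, curv n μ u x)) := by
    rw [← integral_prod_dens hB]
    have hd0 := fun y => dens_pos (n := n) (μ := μ) (u := u) y
    have hp := integrable_prod_dens hB
    have hηm := fun k => (hηc' k).measurable
    have hdm := (continuous_dens (μ := μ) huc).measurable
    generalize dens n μ u = f at *
    refine tendsto_integral_of_dominated_convergence
      (fun p => C * (‖p.1 - p.2‖ ^ (-μ) * (f p.1 * f p.2))) (fun k => ?_) (hp.const_mul C)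
      (fun k => ae_of_all _ fun p => ?_) (ae_of_all _ fun p => ?_)
    · have := hηm k
      exact Measurable.aestronglyMeasurable (by fun_prop)
    · rw [norm_mul, Real.norm_of_nonneg (mul_pos (hd0 _) (hd0 _)).le, ← mul_assoc C]
      have := abs_inner_kernel_le hC (hηL k) hμ0 le_rfl p.1 p.2
      rw [add_zero] at this
      exact mul_le_mul_of_nonneg_right this (mul_pos (hd0 _) (hd0 _)).le
    · refine tendsto_const_nhds.congr' ?_
      filter_upwards [hηX p.1 p.2] with k hk
      rw [hk, real_inner_self_eq_norm_sq]
      rcases eq_or_ne ‖p.1 - p.2‖ 0 with h | h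
      · rw [h, Real.zero_rpow (by linarith)]
        simp
      · rw [Real.rpow_sub_one (by positivity), ← sq_rpow_half (norm_nonneg _)]
        field_simp
  have hr2 : Tendsto (fun k => ∫ p : Euc n × Euc n, (‖p.1 - p.2‖ ^ 2)⁻¹ *
        inner ℝ (η k p.1 • p.1 - η k p.2 • p.2) (p.1 - p.2) * (curv n μ u p.1 * curv n μ u p.2))
      atTop (𝓝 ((∫ x, curv n μ u x) * ∫ x, curv n μ u x)) := by
    rw [← integral_prod_mul, ← Measure.volume_eq_prod]
    have hg0 := curv_nonneg (n := n) (μ := μ) (u := u)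
    have hne : ∀ᵐ p : Euc n × Euc n, p.1 ≠ p.2 := by
      rw [Measure.volume_eq_prod]
      refine (Measure.ae_prod_iff_ae_ae ?_).2 (ae_of_all _ fun x => ae_ne_point hn0 x)
      exact (isClosed_eq continuous_fst continuous_snd).measurableSet.compl
    have hηm := fun k => (hηc' k).measurable
    have hgm := hgm.measurable
    generalize curv n μ u = g at *
    refine tendsto_integral_of_dominated_convergence
      (fun p => C * (g p.1 * g p.2)) (fun k => ?_) ((hgi.mul_prod hgi).const_mul C)
      (fun k => ae_of_all _ fun p => ?_) ?_
    · have := hηm k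
      exact Measurable.aestronglyMeasurable (by fun_prop)
    · rw [norm_mul, Real.norm_of_nonneg (mul_nonneg (hg0 _) (hg0 _))]
      refine mul_le_mul_of_nonneg_right ?_ (mul_nonneg (hg0 _) (hg0 _))
      rcases eq_or_ne ‖p.1 - p.2‖ 0 with h | h
      · rw [h]; simpa using hC
      rw [norm_mul, norm_inv, norm_pow, norm_norm, inv_mul_le_iff₀ (by positivity)]
      calc _ ≤ ‖η k p.1 • p.1 - η k p.2 • p.2‖ * ‖p.1 - p.2‖ := norm_inner_le_norm _ _
        _ ≤ (C * ‖p.1 - p.2‖) * ‖p.1 - p.2‖ := by gcongr; exact hηL k _ _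
        _ = _ := by ring
    · filter_upwards [hne] with p hp
      refine tendsto_const_nhds.congr' ?_
      filter_upwards [hηX p.1 p.2] with k hk
      have : ‖p.1 - p.2‖ ≠ 0 := norm_ne_zero_iff.2 (sub_ne_zero.2 hp)
      rw [hk, real_inner_self_eq_norm_sq]
      field_simp
  have hfin := tendsto_nhds_unique (hl.congr hcomb)
    ((hr1.const_mul (μ / 2)).add ((hr2.const_mul (1 / (2 * betaN n))).const_mul ((2 * n - μ) / 2)))
  set S := ∫ x, curv n μ u x
  have h1 : (2 * n - μ) * (2 * betaN n - S) = 0 := by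
    field_simp at hfin
    linear_combination hfin
  rcases mul_eq_zero.1 h1 with h2 | h2 <;> linarith

end PohozaevLimit

section Inversion

variable {n : ℕ}

/-- Inversion in the sphere of radius `r` centred at the origin. -/
def kv (r : ℝ) (x : Euc n) : Euc n := EuclideanGeometry.inversion 0 r x

lemma kv_eq (r : ℝ) (x : Euc n) : kv r x = (r ^ 2 / ‖x‖ ^ 2) • x := by
  simp [kv, EuclideanGeometry.inversion, div_pow]

lemma norm_kv (r : ℝ) (x : Euc n) : ‖kv r x‖ = r ^ 2 / ‖x‖ := by
  simpa [kv] using EuclideanGeometry.dist_inversion_center (0 : Euc n) x r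

lemma kv_kv {r : ℝ} (hr : r ≠ 0) (x : Euc n) : kv r (kv r x) = x :=
  EuclideanGeometry.inversion_inversion _ hr _

lemma norm_kv_sub_kv {x y : Euc n} (hx : x ≠ 0) (hy : y ≠ 0) (r : ℝ) :
    ‖kv r x - kv r y‖ = r ^ 2 / (‖x‖ * ‖y‖) * ‖x - y‖ := by
  simpa [kv, dist_eq_norm] using EuclideanGeometry.dist_inversion_inversion hx hy r

lemma kv_ne_zero {r : ℝ} (hr : r ≠ 0) {x : Euc n} (hx : x ≠ 0) : kv r x ≠ 0 := by
  rw [kv, Ne, EuclideanGeometry.inversion_eq_center hr]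
  exact hx

lemma continuousAt_kv (r : ℝ) {x : Euc n} (hx : x ≠ 0) : ContinuousAt (kv r) x :=
  ContinuousAt.inversion continuousAt_const continuousAt_const continuousAt_id hx

lemma abs_det_fderiv_kv {r : ℝ} {x : Euc n} :
    |((r / dist x 0) ^ 2 • (((ℝ ∙ (x - 0))ᗮ.reflection : Euc n ≃ₗᵢ[ℝ] Euc n) :
      Euc n →L[ℝ] Euc n)).det| = (r / ‖x‖) ^ (2 * n) := by
  have h1 : ((r / dist x 0) ^ 2 • (((ℝ ∙ (x - 0))ᗮ.reflection : Euc n ≃ₗᵢ[ℝ] Euc n) :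
      Euc n →L[ℝ] Euc n)).det = ((r / dist x 0) ^ 2) ^ n *
        LinearMap.det (ℝ ∙ (x - 0))ᗮ.reflection.toLinearMap := by
    rw [ContinuousLinearMap.det, ContinuousLinearMap.toLinearMap_smul, LinearMap.det_smul,
      finrank_euclideanSpace_fin]
    rfl
  rw [h1, Submodule.det_reflection, abs_mul, abs_pow, abs_pow (-1 : ℝ), abs_neg, abs_one, one_pow,
    mul_one, abs_of_nonneg (sq_nonneg _), dist_zero_right, pow_mul]

lemma image_kv {r : ℝ} (hr : 0 < r) :
    kv r '' {y : Euc n | r < ‖y‖} = ball 0 r \ {0} := by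
  ext z
  simp only [Set.mem_image, Set.mem_ofPred_eq, Set.mem_sdiff, mem_ball, dist_zero_right,
    Set.mem_singleton_iff]
  constructor
  · rintro ⟨y, hy, rfl⟩
    have hy0 : 0 < ‖y‖ := hr.trans hy
    refine ⟨?_, kv_ne_zero hr.ne' (norm_pos_iff.1 hy0)⟩
    rw [norm_kv, div_lt_iff₀ hy0]
    nlinarith
  · rintro ⟨hz, hz0⟩
    have hz1 : 0 < ‖z‖ := norm_pos_iff.2 hz0
    refine ⟨kv r z, ?_, kv_kv hr.ne' z⟩
    rw [norm_kv, lt_div_iff₀ hz1]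
    nlinarith

lemma integral_inversion (hn : 0 < n) {r : ℝ} (hr : 0 < r) {F : Euc n → ℝ} (hF : Integrable F) :
    IntegrableOn (fun y => F y + (r / ‖y‖) ^ (2 * n) * F (kv r y)) {y | r < ‖y‖} ∧
    ∫ y, F y = ∫ y in {y | r < ‖y‖}, (F y + (r / ‖y‖) ^ (2 * n) * F (kv r y)) := by
  have : Nontrivial (Euc n) := by
    have : Nonempty (Fin n) := ⟨⟨0, hn⟩⟩
    infer_instance
  have hs : MeasurableSet {y : Euc n | r < ‖y‖} := measurableSet_lt measurable_const measurable_norm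
  have hne : ∀ y ∈ {y : Euc n | r < ‖y‖}, y ≠ 0 := fun y hy => norm_pos_iff.1 (hr.trans hy)
  have hd : ∀ y ∈ {y : Euc n | r < ‖y‖}, HasFDerivWithinAt (kv r)
      ((r / dist y 0) ^ 2 • (((ℝ ∙ (y - 0))ᗮ.reflection : Euc n ≃ₗᵢ[ℝ] Euc n) :
        Euc n →L[ℝ] Euc n)) {y | r < ‖y‖} y := fun y hy =>
    (EuclideanGeometry.hasFDerivAt_inversion (hne y hy)).hasFDerivWithinAt
  have hinj : Set.InjOn (kv r : Euc n → Euc n) {y | r < ‖y‖} :=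
    (EuclideanGeometry.inversion_injective (0 : Euc n) hr.ne').injOn
  have h1 := (integrableOn_image_iff_integrableOn_abs_det_fderiv_smul volume hs hd hinj F).1
    hF.integrableOn
  have h2 := integral_image_eq_integral_abs_det_fderiv_smul volume hs hd hinj F
  simp_rw [abs_det_fderiv_kv, smul_eq_mul] at h1 h2
  refine ⟨hF.integrableOn.add h1, ?_⟩
  rw [integral_add hF.integrableOn h1, ← h2, image_kv hr, ← integral_add_compl hs hF]
  congr 1
  refine setIntegral_congr_set ?_
  have hc : {y : Euc n | r < ‖y‖}ᶜ = closedBall 0 r := by ext; simp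
  rw [hc]
  have h0 : (ball (0 : Euc n) r \ {0} : Set (Euc n)) =ᵐ[volume] ball 0 r :=
    sdiff_null_ae_eq_self (measure_singleton 0)
  have h3 : (closedBall (0 : Euc n) r \ sphere 0 r : Set (Euc n)) =ᵐ[volume] closedBall 0 r :=
    sdiff_null_ae_eq_self (Measure.addHaar_sphere volume 0 r)
  rw [closedBall_sdiff_sphere] at h3
  exact (h0.trans h3).symm

/-- The distance from `y` to the reflected point, rescaled. -/
def rdist (r : ℝ) (x y : Euc n) : ℝ := ‖x‖ / r * ‖kv r x - y‖

lemma norm_sub_kv {r : ℝ} (hr : 0 < r) {x y : Euc n} (hx : x ≠ 0) (hy : y ≠ 0) :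
    ‖x - kv r y‖ = r / ‖y‖ * rdist r x y := by
  have h := norm_kv_sub_kv (kv_ne_zero hr.ne' hx) hy r
  have hx' := norm_pos_iff.2 hx
  have hy' := norm_pos_iff.2 hy
  rw [kv_kv hr.ne', norm_kv] at h
  rw [h, rdist]
  field_simp

lemma rdist_kv {r : ℝ} (hr : 0 < r) {x y : Euc n} (hx : x ≠ 0) (hy : y ≠ 0) :
    rdist r x (kv r y) = r / ‖y‖ * ‖x - y‖ := by
  have hx' := norm_pos_iff.2 hx
  have hy' := norm_pos_iff.2 hy
  rw [rdist, norm_kv_sub_kv hx hy]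
  field_simp

lemma rdist_sq {r : ℝ} (hr : 0 < r) {x : Euc n} (hx : x ≠ 0) (y : Euc n) :
    rdist r x y ^ 2 = ‖x - y‖ ^ 2 + (‖x‖ ^ 2 - r ^ 2) * (‖y‖ ^ 2 - r ^ 2) / r ^ 2 := by
  have hx' := norm_pos_iff.2 hx
  rw [rdist, mul_pow, kv_eq, norm_sub_sq_real, norm_sub_sq_real, norm_smul, real_inner_smul_left,
    Real.norm_of_nonneg (by positivity)]
  field_simp
  ring

lemma rdist_nonneg {r : ℝ} (hr : 0 < r) (x y : Euc n) : 0 ≤ rdist r x y := by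
  unfold rdist; positivity

end Inversion

section Reflection

variable {n : ℕ} {μ : ℝ} {u : Euc n → ℝ}

/-- Difference between `u` and its reflection in the sphere of radius `r`. -/
def wDiff (u : Euc n → ℝ) (r : ℝ) (x : Euc n) : ℝ := u x - u (kv r x) + 2 * log (‖x‖ / r)

/-- Difference between `V` and its reflection in the sphere of radius `r`. -/
def zDiff (n : ℕ) (μ : ℝ) (u : Euc n → ℝ) (r : ℝ) (x : Euc n) : ℝ :=
  V n μ u x - (r / ‖x‖) ^ μ * V n μ u (kv r x)

/-- Difference between `dens` and its reflection. -/
def densDiff (n : ℕ) (μ : ℝ) (u : Euc n → ℝ) (r : ℝ) (x : Euc n) : ℝ :=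
  dens n μ u x - (r / ‖x‖) ^ (2 * n - μ) * dens n μ u (kv r x)

/-- Difference between `curv` and its reflection. -/
def curvDiff (n : ℕ) (μ : ℝ) (u : Euc n → ℝ) (r : ℝ) (x : Euc n) : ℝ :=
  curv n μ u x - (r / ‖x‖) ^ (2 * n) * curv n μ u (kv r x)

lemma norm_sub_lt_rdist {r : ℝ} (hr : 0 < r) {x y : Euc n} (hx : r < ‖x‖) (hy : r < ‖y‖) :
    ‖x - y‖ < rdist r x y := by
  refine lt_of_pow_lt_pow_left₀ 2 (rdist_nonneg hr x y) ?_
  rw [rdist_sq hr (norm_pos_iff.1 (hr.trans hx))]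
  have h1 : 0 < ‖x‖ ^ 2 - r ^ 2 := by nlinarith
  have h2 : 0 < ‖y‖ ^ 2 - r ^ 2 := by nlinarith
  have : 0 < (‖x‖ ^ 2 - r ^ 2) * (‖y‖ ^ 2 - r ^ 2) / r ^ 2 := by positivity
  linarith

lemma reflected_dens {r : ℝ} (hr : 0 < r) {x : Euc n} (hx : 0 < ‖x‖) :
    (r / ‖x‖) ^ (2 * n - μ) * dens n μ u (kv r x) =
      Real.exp ((2 * n - μ) / 2 * (u x - wDiff u r x)) := by
  rw [Real.rpow_def_of_pos (by positivity), dens, ← Real.exp_add, wDiff,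
    log_div hr.ne' hx.ne', log_div hx.ne' hr.ne']
  congr 1
  ring

lemma densDiff_eq {r : ℝ} (hr : 0 < r) {x : Euc n} (hx : 0 < ‖x‖) :
    densDiff n μ u r x = Real.exp ((2 * n - μ) / 2 * u x) -
      Real.exp ((2 * n - μ) / 2 * (u x - wDiff u r x)) := by
  rw [densDiff, reflected_dens hr hx, dens]

lemma densDiff_nonneg (hμn : μ < n) {r : ℝ} (hr : 0 < r) {x : Euc n} (hx : 0 < ‖x‖)
    (hw : 0 ≤ wDiff u r x) : 0 ≤ densDiff n μ u r x := by
  have hn : (0 : ℝ) ≤ n := n.cast_nonneg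
  rw [densDiff_eq hr hx, sub_nonneg, Real.exp_le_exp]
  exact mul_le_mul_of_nonneg_left (by linarith) (by linarith)

lemma densDiff_pos (hμn : μ < n) {r : ℝ} (hr : 0 < r) {x : Euc n} (hx : 0 < ‖x‖)
    (hw : 0 < wDiff u r x) : 0 < densDiff n μ u r x := by
  have hn : (0 : ℝ) ≤ n := n.cast_nonneg
  rw [densDiff_eq hr hx, sub_pos, Real.exp_lt_exp]
  exact mul_lt_mul_of_pos_left (by linarith) (by linarith)

lemma curvDiff_eq {r : ℝ} (hr : 0 < r) {x : Euc n} (hx : 0 < ‖x‖) :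
    curvDiff n μ u r x = V n μ u x * densDiff n μ u r x +
      zDiff n μ u r x * ((r / ‖x‖) ^ (2 * n - μ) * dens n μ u (kv r x)) := by
  have h : (r / ‖x‖) ^ (2 * n) = (r / ‖x‖) ^ μ * (r / ‖x‖) ^ (2 * n - μ) := by
    rw [← Real.rpow_add (by positivity), ← Real.rpow_natCast]
    congr 1
    push_cast
    ring
  rw [curvDiff, densDiff, zDiff, curv, curv, h]
  ring

lemma wDiff_eq_integral (hn : 2 ≤ n) (hμ0 : 0 < μ) (hμn : μ < n) (hu : ContDiff ℝ 1 u)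
    (hB : CondB n μ u) (hIE : IE n μ u) {r : ℝ} (hr : 0 < r) {x : Euc n} (hx : r < ‖x‖) :
    IntegrableOn (fun y => log (rdist r x y / ‖x - y‖) * curvDiff n μ u r y) {y | r < ‖y‖} ∧
    wDiff u r x = 1 / betaN n *
      ∫ y in {y | r < ‖y‖}, log (rdist r x y / ‖x - y‖) * curvDiff n μ u r y := by
  have hn0 : 0 < n := by lia
  have hβ := betaN_pos n hn0
  have hS := integral_curv_eq hn hμ0 hμn hu hB hIE
  have huc := hu.continuous
  have hx0 : 0 < ‖x‖ := hr.trans hx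
  have hxne := norm_pos_iff.1 hx0
  obtain ⟨C, hC⟩ := hIE
  have hi1 := integrable_log_mul_curv hn0 hμ0 hμn huc hB x
  have hi2 := integrable_log_mul_curv hn0 hμ0 hμn huc hB (kv r x)
  have hi3 := (integrable_curv hB).const_mul (log (‖x‖ / r))
  have hae : ∀ᵐ y : Euc n, log ((‖y‖ + 1) / ‖x - y‖) * curv n μ u y -
      log ((‖y‖ + 1) / ‖kv r x - y‖) * curv n μ u y + log (‖x‖ / r) * curv n μ u y =
      log (rdist r x y / ‖x - y‖) * curv n μ u y := by
    filter_upwards [ae_ne_point hn0 x, ae_ne_point hn0 (kv r x)] with y h1 h2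
    have h1' : ‖x - y‖ ≠ 0 := norm_ne_zero_iff.2 (sub_ne_zero.2 h1)
    have h2' : ‖kv r x - y‖ ≠ 0 := norm_ne_zero_iff.2 (sub_ne_zero.2 h2)
    have h3 : ‖y‖ + 1 ≠ 0 := by positivity
    have h4 : ‖x‖ / r ≠ 0 := by positivity
    rw [rdist, log_div h3 h1', log_div h3 h2', log_div (mul_ne_zero h4 h2') h1', log_mul h4 h2']
    ring
  have hF : Integrable fun y => log (rdist r x y / ‖x - y‖) * curv n μ u y :=
    ((hi1.sub hi2).add hi3).congr hae
  have hW : wDiff u r x = 1 / betaN n * ∫ y, log (rdist r x y / ‖x - y‖) * curv n μ u y := by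
    have hi12 : Integrable fun y => log ((‖y‖ + 1) / ‖x - y‖) * curv n μ u y -
        log ((‖y‖ + 1) / ‖kv r x - y‖) * curv n μ u y := hi1.sub hi2
    rw [← integral_congr_ae hae, integral_add hi12 hi3, integral_sub hi1 hi2,
      integral_const_mul, hS, wDiff, hC x, hC (kv r x)]
    change 1 / betaN n * (∫ y, log ((‖y‖ + 1) / ‖x - y‖) * curv n μ u y) + C -
      (1 / betaN n * (∫ y, log ((‖y‖ + 1) / ‖kv r x - y‖) * curv n μ u y) + C) + _ = _
    field_simp
    ring
  obtain ⟨h1, h2⟩ := integral_inversion hn0 hr hF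
  have hs : MeasurableSet {y : Euc n | r < ‖y‖} := measurableSet_lt measurable_const measurable_norm
  have heq : ∀ y ∈ {y : Euc n | r < ‖y‖}, log (rdist r x y / ‖x - y‖) * curv n μ u y +
      (r / ‖y‖) ^ (2 * n) * (log (rdist r x (kv r y) / ‖x - kv r y‖) * curv n μ u (kv r y)) =
      log (rdist r x y / ‖x - y‖) * curvDiff n μ u r y := fun y hy => by
    have hy0 : 0 < ‖y‖ := hr.trans hy
    have hyne := norm_pos_iff.1 hy0
    have h : rdist r x (kv r y) / ‖x - kv r y‖ = (rdist r x y / ‖x - y‖)⁻¹ := by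
      rw [rdist_kv hr hxne hyne, norm_sub_kv hr hxne hyne, inv_div,
        mul_div_mul_left _ _ (by positivity)]
    rw [h, log_inv, curvDiff]
    ring
  refine ⟨h1.congr_fun heq hs, ?_⟩
  rw [hW, h2, setIntegral_congr_fun hs heq]

lemma zDiff_eq_integral (hn : 0 < n) (hμ0 : 0 < μ) (hμn : μ < n) (hu : Continuous u)
    (hf : Integrable (dens n μ u)) {r : ℝ} (hr : 0 < r) {x : Euc n} (hx : r < ‖x‖) :
    zDiff n μ u r x =
      ∫ y in {y | r < ‖y‖}, (‖x - y‖ ^ (-μ) - rdist r x y ^ (-μ)) * densDiff n μ u r y := by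
  have hx0 : 0 < ‖x‖ := hr.trans hx
  have hxne := norm_pos_iff.1 hx0
  have hi1 := integrable_rpow_mul_dens hn hμ0 hμn hu hf x
  have hi2 := (integrable_rpow_mul_dens hn hμ0 hμn hu hf (kv r x)).const_mul ((r / ‖x‖) ^ μ)
  have hpt : ∀ y : Euc n, ‖x - y‖ ^ (-μ) * dens n μ u y -
      (r / ‖x‖) ^ μ * (‖kv r x - y‖ ^ (-μ) * dens n μ u y) =
      (‖x - y‖ ^ (-μ) - rdist r x y ^ (-μ)) * dens n μ u y := fun y => by
    have h : (‖x‖ / r) ^ (-μ) = (r / ‖x‖) ^ μ := by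
      rw [Real.rpow_neg (by positivity), ← Real.inv_rpow (by positivity), inv_div]
    rw [rdist, Real.mul_rpow (by positivity) (norm_nonneg _), h]
    ring
  have hF : Integrable fun y => (‖x - y‖ ^ (-μ) - rdist r x y ^ (-μ)) * dens n μ u y :=
    (hi1.sub hi2).congr (ae_of_all _ hpt)
  have hZ : zDiff n μ u r x = ∫ y, (‖x - y‖ ^ (-μ) - rdist r x y ^ (-μ)) * dens n μ u y := by
    rw [← integral_congr_ae (ae_of_all _ hpt), integral_sub hi1 hi2, integral_const_mul, zDiff,
      V_eq, V_eq]
  rw [hZ, (integral_inversion hn hr hF).2]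
  refine setIntegral_congr_fun (measurableSet_lt measurable_const measurable_norm) fun y hy => ?_
  have hy0 : 0 < ‖y‖ := hr.trans hy
  have hyne := norm_pos_iff.1 hy0
  have hrd := rdist_nonneg hr x y
  have h2n : (r / ‖y‖) ^ (2 * n) * (r / ‖y‖) ^ (-μ) = (r / ‖y‖) ^ (2 * n - μ) := by
    rw [← Real.rpow_natCast, ← Real.rpow_add (by positivity)]
    push_cast
    rfl
  beta_reduce
  rw [rdist_kv hr hxne hyne, norm_sub_kv hr hxne hyne, densDiff, ← h2n,
    Real.mul_rpow (by positivity) hrd, Real.mul_rpow (by positivity) (norm_nonneg _)]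
  ring

lemma zDiff_nonneg (hn : 0 < n) (hμ0 : 0 < μ) (hμn : μ < n) (hu : Continuous u)
    (hf : Integrable (dens n μ u)) {r : ℝ} (hr : 0 < r)
    (hW : ∀ x, r < ‖x‖ → 0 ≤ wDiff u r x) {x : Euc n} (hx : r < ‖x‖) :
    0 ≤ zDiff n μ u r x := by
  rw [zDiff_eq_integral hn hμ0 hμn hu hf hr hx]
  refine setIntegral_nonneg_of_ae_restrict ?_
  rw [EventuallyLE, ae_restrict_iff' (measurableSet_lt measurable_const measurable_norm)]
  filter_upwards [ae_ne_point hn x] with y hxy hy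
  have hd : 0 < ‖x - y‖ := norm_pos_iff.2 (sub_ne_zero.2 hxy)
  refine mul_nonneg (sub_nonneg.2 ?_) (densDiff_nonneg hμn hr (hr.trans hy) (hW y hy))
  exact Real.rpow_le_rpow_of_nonpos hd (norm_sub_lt_rdist hr hx hy).le (by linarith)

lemma zDiff_eq_zero (hn : 0 < n) (hμ0 : 0 < μ) (hμn : μ < n) (hu : Continuous u)
    (hf : Integrable (dens n μ u)) {r : ℝ} (hr : 0 < r)
    (hW : ∀ x, r < ‖x‖ → wDiff u r x = 0) {x : Euc n} (hx : r < ‖x‖) :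
    zDiff n μ u r x = 0 := by
  rw [zDiff_eq_integral hn hμ0 hμn hu hf hr hx]
  refine setIntegral_eq_zero_of_forall_eq_zero fun y hy => ?_
  rw [densDiff_eq hr (hr.trans hy), hW y hy]
  simp

lemma curvDiff_nonneg (hn : 0 < n) (hμ0 : 0 < μ) (hμn : μ < n) (hu : Continuous u)
    (hf : Integrable (dens n μ u)) {r : ℝ} (hr : 0 < r)
    (hW : ∀ x, r < ‖x‖ → 0 ≤ wDiff u r x) {x : Euc n} (hx : r < ‖x‖) :
    0 ≤ curvDiff n μ u r x := by
  have hx0 : 0 < ‖x‖ := hr.trans hx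
  rw [curvDiff_eq hr hx0]
  exact add_nonneg (mul_nonneg (V_nonneg x) (densDiff_nonneg hμn hr hx0 (hW x hx)))
    (mul_nonneg (zDiff_nonneg hn hμ0 hμn hu hf hr hW hx)
      (mul_nonneg (by positivity) (dens_pos _).le))

lemma curvDiff_pos (hn : 0 < n) (hμ0 : 0 < μ) (hμn : μ < n) (hu : Continuous u)
    (hf : Integrable (dens n μ u)) {r : ℝ} (hr : 0 < r)
    (hW : ∀ x, r < ‖x‖ → 0 ≤ wDiff u r x) {x : Euc n} (hx : r < ‖x‖) (hwx : 0 < wDiff u r x) :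
    0 < curvDiff n μ u r x := by
  have hx0 : 0 < ‖x‖ := hr.trans hx
  rw [curvDiff_eq hr hx0]
  exact add_pos_of_pos_of_nonneg (mul_pos (V_pos hn hμ0 hμn hu hf x) (densDiff_pos hμn hr hx0 hwx))
    (mul_nonneg (zDiff_nonneg hn hμ0 hμn hu hf hr hW hx)
      (mul_nonneg (by positivity) (dens_pos _).le))

lemma continuousAt_wDiff (hu : Continuous u) {r : ℝ} (hr : 0 < r) {x : Euc n} (hx : x ≠ 0) :
    ContinuousAt (wDiff u r) x := by
  have h1 := continuousAt_kv r hx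
  have h2 : ‖x‖ / r ≠ 0 := by positivity
  have h3 : ContinuousAt (fun y : Euc n => ‖y‖ / r) x := continuous_norm.continuousAt.div_const r
  unfold wDiff
  exact (hu.continuousAt.sub (hu.continuousAt.comp h1)).add ((h3.log h2).const_mul 2)

lemma exists_wDiff_lower_bound (hn : 2 ≤ n) (hμ0 : 0 < μ) (hμn : μ < n) (hu : ContDiff ℝ 1 u)
    (hB : CondB n μ u) (hIE : IE n μ u) {r : ℝ} (hr : 0 < r)
    (hW : ∀ x, r < ‖x‖ → 0 ≤ wDiff u r x) {x₀ : Euc n} (hx₀ : r < ‖x₀‖)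
    (hw₀ : 0 < wDiff u r x₀) :
    ∃ c d M : ℝ, 0 < c ∧ 0 < d ∧ 0 < M ∧ ∀ x, r < ‖x‖ →
      c * log (1 + (‖x‖ ^ 2 - r ^ 2) * d / (‖x‖ + M) ^ 2) ≤ wDiff u r x := by
  have hn0 : 0 < n := by lia
  have hβ := betaN_pos n hn0
  have huc := hu.continuous
  have hx₀0 : 0 < ‖x₀‖ := hr.trans hx₀
  have hU : ∀ᶠ y in 𝓝 x₀, (r + ‖x₀‖) / 2 < ‖y‖ ∧ 0 < wDiff u r y :=
    (continuous_norm.continuousAt.eventually (lt_mem_nhds (by linarith))).and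
      ((continuousAt_wDiff huc hr (norm_pos_iff.1 hx₀0)).eventually (lt_mem_nhds hw₀))
  obtain ⟨δ, hδ, hball⟩ := Metric.eventually_nhds_iff_ball.1 hU
  set D := ball x₀ δ
  have hDs : D ⊆ {y : Euc n | r < ‖y‖} := fun y hy => by
    have := (hball y hy).1
    simp only [Set.mem_ofPred_eq]
    linarith
  have hgi := integrable_curv hB
  have hs : MeasurableSet {y : Euc n | r < ‖y‖} := measurableSet_lt measurable_const measurable_norm
  have hGi : IntegrableOn (curvDiff n μ u r) {y | r < ‖y‖} := by
    have h := (integral_inversion hn0 hr hgi).1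
    have h3 : IntegrableOn (fun y => 2 * curv n μ u y -
        (curv n μ u y + (r / ‖y‖) ^ (2 * n) * curv n μ u (kv r y))) {y | r < ‖y‖} :=
      (hgi.integrableOn.const_mul 2).sub h
    refine h3.congr_fun (fun y _ => ?_) hs
    simp only [curvDiff]
    ring
  have hGpos : 0 < ∫ y in D, curvDiff n μ u r y := by
    rw [setIntegral_pos_iff_support_of_nonneg_ae]
    · refine (measure_ball_pos volume x₀ hδ).trans_le (measure_mono fun y hy => ⟨?_, hy⟩)
      exact (curvDiff_pos hn0 hμ0 hμn huc hB.1 hr hW (hDs hy) (hball y hy).2).ne'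
    · rw [EventuallyLE, ae_restrict_iff' measurableSet_ball]
      exact ae_of_all _ fun y hy => curvDiff_nonneg hn0 hμ0 hμn huc hB.1 hr hW (hDs hy)
    · exact hGi.mono_set hDs
  have hd : 0 < ((r + ‖x₀‖) / 2) ^ 2 - r ^ 2 := by nlinarith
  refine ⟨1 / (2 * betaN n) * ∫ y in D, curvDiff n μ u r y,
    (((r + ‖x₀‖) / 2) ^ 2 - r ^ 2) / r ^ 2, ‖x₀‖ + δ, by positivity, by positivity, by positivity,
    fun x hx => ?_⟩
  have hx0 : 0 < ‖x‖ := hr.trans hx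
  obtain ⟨hi, hWx⟩ := wDiff_eq_integral hn hμ0 hμn hu hB hIE hr hx
  set q := 1 + (‖x‖ ^ 2 - r ^ 2) * ((((r + ‖x₀‖) / 2) ^ 2 - r ^ 2) / r ^ 2) /
    (‖x‖ + (‖x₀‖ + δ)) ^ 2 with hq
  have hxr : 0 < ‖x‖ ^ 2 - r ^ 2 := by nlinarith
  have hq0 : 0 < q := by positivity
  have h1 : ∫ y in D, 1 / 2 * log q * curvDiff n μ u r y ≤
      ∫ y in D, log (rdist r x y / ‖x - y‖) * curvDiff n μ u r y := by
    refine setIntegral_mono_on_ae ((hGi.mono_set hDs).const_mul _) (hi.mono_set hDs)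
      measurableSet_ball ?_
    filter_upwards [ae_ne_point hn0 x] with y hxy hy
    refine mul_le_mul_of_nonneg_right ?_ (curvDiff_nonneg hn0 hμ0 hμn huc hB.1 hr hW (hDs hy))
    have hd' : 0 < ‖x - y‖ := norm_pos_iff.2 (sub_ne_zero.2 hxy)
    have hlt := norm_sub_lt_rdist hr hx (hDs hy)
    have h2 : q ≤ (rdist r x y / ‖x - y‖) ^ 2 := by
      rw [div_pow, rdist_sq hr (norm_pos_iff.1 hx0), add_div, div_self (by positivity), hq]
      have h3 : ‖x - y‖ ≤ ‖x‖ + (‖x₀‖ + δ) := by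
        have h4 := norm_sub_le x y
        have h5 := norm_le_norm_add_norm_sub' y x₀
        have h6 : ‖y - x₀‖ < δ := by simpa [D, dist_eq_norm] using hy
        linarith
      have h7 : ((r + ‖x₀‖) / 2) ^ 2 - r ^ 2 ≤ ‖y‖ ^ 2 - r ^ 2 := by
        have := (hball y hy).1
        gcongr
      rw [mul_div_assoc (‖x‖ ^ 2 - r ^ 2) (‖y‖ ^ 2 - r ^ 2)]
      have h8 : 0 ≤ ‖y‖ ^ 2 - r ^ 2 := hd.le.trans h7
      gcongr
    have h3 := log_le_log hq0 h2
    rw [log_pow] at h3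
    push_cast at h3
    linarith
  have h2 : ∫ y in D, log (rdist r x y / ‖x - y‖) * curvDiff n μ u r y ≤
      ∫ y in {y | r < ‖y‖}, log (rdist r x y / ‖x - y‖) * curvDiff n μ u r y := by
    refine setIntegral_mono_set hi ?_ hDs.eventuallyLE
    rw [EventuallyLE, ae_restrict_iff' hs]
    filter_upwards [ae_ne_point hn0 x] with y hxy hy
    have hd' : 0 < ‖x - y‖ := norm_pos_iff.2 (sub_ne_zero.2 hxy)
    refine mul_nonneg (log_nonneg ?_) (curvDiff_nonneg hn0 hμ0 hμn huc hB.1 hr hW hy)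
    rw [one_le_div hd']
    exact (norm_sub_lt_rdist hr hx hy).le
  rw [hWx]
  rw [integral_const_mul] at h1
  calc _ = 1 / betaN n * (1 / 2 * log q * ∫ y in D, curvDiff n μ u r y) := by field_simp
    _ ≤ _ := by gcongr; exact h1.trans h2

lemma exists_lower_bound_at_infinity (hn : 2 ≤ n) (hμ0 : 0 < μ) (hμn : μ < n)
    (hu : ContDiff ℝ 1 u) (hB : CondB n μ u) (hIE : IE n μ u) :
    ∃ C, ∀ x : Euc n, 1 ≤ ‖x‖ → C ≤ u x + 2 * log ‖x‖ := by
  have hn0 : 0 < n := by lia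
  have hβ := betaN_pos n hn0
  have hS := integral_curv_eq hn hμ0 hμn hu hB hIE
  have huc := hu.continuous
  obtain ⟨C, hC⟩ := hIE
  refine ⟨C, fun x hx => ?_⟩
  have hi1 := integrable_log_mul_curv hn0 hμ0 hμn huc hB x
  have hi3 := (integrable_curv hB).const_mul (log ‖x‖)
  have h : 0 ≤ ∫ y, (log ((‖y‖ + 1) / ‖x - y‖) * curv n μ u y + log ‖x‖ * curv n μ u y) := by
    refine integral_nonneg_of_ae ?_
    filter_upwards [ae_ne_point hn0 x] with y hxy
    have hd : 0 < ‖x - y‖ := norm_pos_iff.2 (sub_ne_zero.2 hxy)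
    rw [← add_mul, ← log_mul (by positivity) (by positivity)]
    refine mul_nonneg (log_nonneg ?_) (curv_nonneg y)
    rw [div_mul_eq_mul_div, one_le_div hd]
    have := norm_sub_le x y
    nlinarith [norm_nonneg y]
  rw [integral_add hi1 hi3, integral_const_mul, hS] at h
  have hux : u x = 1 / betaN n * (∫ y, log ((‖y‖ + 1) / ‖x - y‖) * curv n μ u y) + C := hC x
  have h2 : 0 ≤ 1 / betaN n * ((∫ y, log ((‖y‖ + 1) / ‖x - y‖) * curv n μ u y) +
    log ‖x‖ * (2 * betaN n)) := by positivity
  have h3 : 1 / betaN n * (log ‖x‖ * (2 * betaN n)) = 2 * log ‖x‖ := by field_simp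
  rw [mul_add, h3] at h2
  linarith

end Reflection

section MovingSpheres

variable {n : ℕ} {μ : ℝ} {u : Euc n → ℝ}

/-- Outside the sphere of radius `r`, the function `u` dominates its reflection. -/
def Dominates (u : Euc n → ℝ) (r : ℝ) : Prop := ∀ x, r < ‖x‖ → 0 ≤ wDiff u r x

/-- The radial derivative of `u + log ‖x‖`, multiplied by `‖x‖`. -/
def radialDeriv (u : Euc n → ℝ) (x : Euc n) : ℝ := fderiv ℝ u x x + 1

lemma continuous_radialDeriv (hu : ContDiff ℝ 1 u) : Continuous (radialDeriv u) :=
  ((hu.continuous_fderiv one_ne_zero).clm_apply continuous_id).add continuous_const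

lemma hasDerivAt_ray (hu : ContDiff ℝ 1 u) (x : Euc n) {t : ℝ} (ht : 0 < t) :
    HasDerivAt (fun s : ℝ => u (s • x) + log s) (radialDeriv u (t • x) / t) t := by
  have h1 : HasFDerivAt u (fderiv ℝ u (t • x)) (t • x) :=
    (hu.differentiable one_ne_zero (t • x)).hasFDerivAt
  have h2 : HasDerivAt (fun s : ℝ => s • x) x t := by simpa using (hasDerivAt_id t).smul_const x
  refine ((h1.comp_hasDerivAt t h2).add (hasDerivAt_log ht.ne')).congr_deriv ?_
  rw [radialDeriv, map_smul, smul_eq_mul]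
  field_simp

lemma wDiff_smul {r t : ℝ} (hr : 0 < r) (ht : 0 < t) {x : Euc n} (hx : ‖x‖ = r) :
    wDiff u r (t • x) = (u (t • x) + log t) - (u (t⁻¹ • x) + log t⁻¹) := by
  have h1 : kv r (t • x) = t⁻¹ • x := by
    rw [kv_eq, norm_smul, hx, smul_smul, Real.norm_of_nonneg ht.le]
    congr 1
    field_simp
  rw [wDiff, h1, norm_smul, hx, Real.norm_of_nonneg ht.le, mul_div_assoc, div_self hr.ne', mul_one,
    log_inv]
  ring

lemma wDiff_nonneg_of_radialDeriv (hu : ContDiff ℝ 1 u) {r : ℝ} (hr : 0 < r) {x : Euc n}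
    (hx : r < ‖x‖) (h : ∀ t ∈ Set.Icc (r ^ 2 / ‖x‖ ^ 2) 1, 0 ≤ radialDeriv u (t • x)) :
    0 ≤ wDiff u r x := by
  have hx0 : 0 < ‖x‖ := hr.trans hx
  have ha : 0 < r ^ 2 / ‖x‖ ^ 2 := by positivity
  have ha1 : r ^ 2 / ‖x‖ ^ 2 ≤ 1 := by
    rw [div_le_one (by positivity)]
    gcongr
  have hm : MonotoneOn (fun s : ℝ => u (s • x) + log s) (Set.Icc (r ^ 2 / ‖x‖ ^ 2) 1) := by
    have hd := fun t (ht : t ∈ Set.Icc (r ^ 2 / ‖x‖ ^ 2) 1) =>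
      hasDerivAt_ray hu x (ha.trans_le ht.1)
    refine monotoneOn_of_deriv_nonneg (convex_Icc _ _)
      (fun t ht => (hd t ht).continuousAt.continuousWithinAt)
      (fun t ht => (hd t (interior_subset ht)).differentiableAt.differentiableWithinAt)
      fun t ht => ?_
    rw [(hd t (interior_subset ht)).deriv]
    exact div_nonneg (h t (interior_subset ht)) (ha.trans_le (interior_subset ht).1).le
  have h1 := hm ⟨le_rfl, ha1⟩ ⟨ha1, le_rfl⟩ ha1
  have h2 : log (r ^ 2 / ‖x‖ ^ 2) = -(2 * log (‖x‖ / r)) := by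
    rw [← div_pow, log_pow, ← inv_div, log_inv]
    push_cast
    ring
  simp only [one_smul, log_one, ← kv_eq, h2] at h1
  rw [wDiff]
  linarith

lemma wDiff_eq {r : ℝ} (hr : 0 < r) {x : Euc n} (hx : 0 < ‖x‖) :
    wDiff u r x = u x + 2 * log ‖x‖ - u (kv r x) - 2 * log r := by
  rw [wDiff, log_div hx.ne' hr.ne']
  ring

/-- For small radii the reflection is dominated. -/
lemma exists_dominates (hn : 2 ≤ n) (hμ0 : 0 < μ) (hμn : μ < n)
    (hu : ContDiff ℝ 1 u) (hB : CondB n μ u) (hIE : IE n μ u) :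
    ∃ r₀ > 0, ∀ r, 0 < r → r ≤ r₀ → Dominates u r := by
  have hnear : ∀ᶠ x in 𝓝 (0 : Euc n), 0 < radialDeriv u x :=
    (continuous_radialDeriv hu).continuousAt.eventually (lt_mem_nhds (by simp [radialDeriv]))
  obtain ⟨s, hs, hball⟩ := Metric.eventually_nhds_iff_ball.1 hnear
  obtain ⟨C, hC⟩ := exists_lower_bound_at_infinity hn hμ0 hμn hu hB hIE
  obtain ⟨M, hM⟩ := (isCompact_closedBall (0 : Euc n) 1).exists_bound_of_continuousOn
    hu.continuous.continuousOn
  have hM' : ∀ x : Euc n, ‖x‖ ≤ 1 → |u x| ≤ M := fun x hx => hM x (by simpa using hx)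
  set C' := min C (-M + 2 * log s)
  have hC' : ∀ x : Euc n, s ≤ ‖x‖ → C' ≤ u x + 2 * log ‖x‖ := fun x hx => by
    rcases le_total 1 ‖x‖ with h1 | h1
    · exact (min_le_left _ _).trans (hC x h1)
    · have h2 := log_le_log hs hx
      have h3 := (abs_le.1 (hM' x h1)).1
      exact (min_le_right _ _).trans (by linarith)
  refine ⟨min (min 1 s) (Real.exp ((C' - M) / 2)), by positivity, fun r hr hr₀ x hx => ?_⟩
  have hx0 : 0 < ‖x‖ := hr.trans hx
  rcases lt_or_ge ‖x‖ s with hxs | hxs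
  · refine wDiff_nonneg_of_radialDeriv hu hr hx fun t ht => (hball _ ?_).le
    have ht0 : 0 ≤ t := le_trans (by positivity) ht.1
    rw [mem_ball_zero_iff, norm_smul, Real.norm_of_nonneg ht0]
    nlinarith [ht.2]
  · have hr1 : r ≤ 1 := hr₀.trans ((min_le_left _ _).trans (min_le_left _ _))
    have hrs : r ≤ s := hr₀.trans ((min_le_left _ _).trans (min_le_right _ _))
    have hre := log_le_log hr (hr₀.trans (min_le_right _ _))
    rw [log_exp] at hre
    have hk : ‖kv r x‖ ≤ 1 := by
      rw [norm_kv, div_le_one hx0]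
      nlinarith
    have h1 := (abs_le.1 (hM' _ hk)).2
    have h2 := hC' x hxs
    rw [wDiff_eq hr hx0]
    linarith

/-- Domination cannot hold for all radii. -/
lemma not_forall_dominates (hn : 0 < n) (hμ0 : 0 < μ) (hμn : μ < n)
    (hu : Continuous u) (hf : Integrable (dens n μ u)) :
    ¬ ∀ r, 0 < r → Dominates u r := by
  intro hall
  obtain ⟨M, hM⟩ := (isCompact_closedBall (0 : Euc n) 1).exists_bound_of_continuousOn
    hu.continuousOn
  have hlow : ∀ x : Euc n, 1 < ‖x‖ → -M - log ‖x‖ ≤ u x := fun x hx => by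
    have hx0 : 0 < ‖x‖ := one_pos.trans hx
    have hr : 0 < √‖x‖ := Real.sqrt_pos.2 hx0
    have hlt : √‖x‖ < ‖x‖ := by
      rw [Real.sqrt_lt' hx0]
      nlinarith
    have h1 := hall _ hr x hlt
    have hk : ‖kv (√‖x‖) x‖ ≤ 1 := by
      rw [norm_kv, Real.sq_sqrt hx0.le, div_self hx0.ne']
    have h2 := (abs_le.1 (hM _ (by simpa using hk))).1
    rw [wDiff_eq hr hx0, Real.log_sqrt hx0.le] at h1
    linarith
  set a : ℝ := (2 * n - μ) / 2 with ha
  have hn0 : (0 : ℝ) ≤ n := n.cast_nonneg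
  have ha0 : 0 ≤ a := by linarith
  have : Nonempty (Fin n) := ⟨⟨0, hn⟩⟩
  set g : ℝ → ℝ := (Set.Ioi (1 : ℝ)).indicator fun s => s ^ (-a) with hg
  have hgi : Integrable fun x : Euc n => g ‖x‖ := by
    refine (hf.const_mul (Real.exp (a * M))).mono' ?_ (ae_of_all _ fun x => ?_)
    · exact (((measurable_id.pow_const (-a)).indicator measurableSet_Ioi).comp
        measurable_norm).aestronglyMeasurable
    · by_cases hx : 1 < ‖x‖
      · have hx0 : 0 < ‖x‖ := one_pos.trans hx
        rw [hg, Set.indicator_of_mem (Set.mem_Ioi.2 hx), Real.norm_of_nonneg (by positivity),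
          Real.rpow_def_of_pos hx0, dens, ← Real.exp_add, Real.exp_le_exp, ← ha]
        nlinarith [mul_le_mul_of_nonneg_left (hlow x hx) ha0]
      · rw [hg, Set.indicator_of_notMem (by simpa using hx), norm_zero]
        exact mul_nonneg (Real.exp_pos _).le (dens_pos _).le
  rw [integrable_fun_norm_addHaar] at hgi
  have h2 : IntegrableOn (fun s : ℝ => s ^ ((n : ℝ) - 1 - a)) (Set.Ioi 1) := by
    refine (hgi.mono_set (Set.Ioi_subset_Ioi zero_le_one)).congr_fun (fun s hs => ?_)
      measurableSet_Ioi
    have hs0 : (0 : ℝ) < s := one_pos.trans hs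
    simp only [hg, Set.indicator_of_mem hs, smul_eq_mul, finrank_euclideanSpace, Fintype.card_fin]
    rw [← Real.rpow_natCast, ← Real.rpow_add hs0, Nat.cast_sub hn]
    push_cast
    rfl
  have h3 := (integrableOn_Ioi_rpow_iff one_pos).1 h2
  linarith

lemma continuousAt_kv_prod {r : ℝ} {x : Euc n} (hx : x ≠ 0) :
    ContinuousAt (fun p : ℝ × Euc n => kv p.1 p.2) (r, x) := by
  simp only [kv_eq]
  have h : ‖x‖ ^ 2 ≠ 0 := by positivity
  exact ((continuousAt_fst.pow 2).div (continuousAt_snd.norm.pow 2) h).smul continuousAt_snd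

lemma continuousAt_wDiff_prod (hu : Continuous u) {r : ℝ} (hr : 0 < r) {x : Euc n} (hx : x ≠ 0) :
    ContinuousAt (fun p : ℝ × Euc n => wDiff u p.1 p.2) (r, x) := by
  have h1 : ContinuousAt (fun p : ℝ × Euc n => u (kv p.1 p.2)) (r, x) :=
    hu.continuousAt.comp (continuousAt_kv_prod hx)
  have h2 : ContinuousAt (fun p : ℝ × Euc n => ‖p.2‖ / p.1) (r, x) :=
    continuousAt_snd.norm.div continuousAt_fst hr.ne'
  have h3 : ‖x‖ / r ≠ 0 := by positivity
  exact ((hu.continuousAt.comp continuousAt_snd).sub h1).add ((h2.log h3).const_mul 2)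

lemma dominates_of_forall_lt (hu : Continuous u) {r : ℝ} (hr : 0 < r)
    (h : ∀ r', 0 < r' → r' < r → Dominates u r') : Dominates u r := by
  intro x hx
  have h1 := continuousAt_wDiff_prod hu hr (norm_pos_iff.1 (hr.trans hx))
  have h2 : ContinuousAt (fun s => wDiff u s x) r :=
    h1.comp (f := fun s : ℝ => (s, x)) (continuousAt_id.prodMk continuousAt_const)
  refine ge_of_tendsto (h2.tendsto.mono_left (nhdsWithin_le_nhds (s := Set.Iio r))) ?_
  filter_upwards [self_mem_nhdsWithin, nhdsWithin_le_nhds (lt_mem_nhds hr)] with s hs hs0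
  exact h s hs0 hs x (lt_trans hs hx)

lemma nonneg_of_hasDerivAt_of_nonneg {f : ℝ → ℝ} {a f' : ℝ} (hf : HasDerivAt f f' a)
    (h0 : f a = 0) (h : ∀ᶠ t in 𝓝[>] a, 0 ≤ f t) : 0 ≤ f' := by
  have h1 := hf.tendsto_slope.mono_left
    (nhdsWithin_mono a fun t (ht : t ∈ Set.Ioi a) => (Set.mem_Ioi.1 ht).ne')
  refine ge_of_tendsto (x := 𝓝[>] a) h1 ?_
  filter_upwards [h, self_mem_nhdsWithin] with t ht hat
  rw [slope_def_field, h0, sub_zero]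
  exact div_nonneg ht (sub_nonneg.2 (le_of_lt hat))

lemma radialDeriv_pos (hu : ContDiff ℝ 1 u) {r c d M : ℝ} (hr : 0 < r) (hc : 0 < c) (hd : 0 < d)
    (hM : 0 < M)
    (h : ∀ x, r < ‖x‖ → c * log (1 + (‖x‖ ^ 2 - r ^ 2) * d / (‖x‖ + M) ^ 2) ≤ wDiff u r x)
    {x : Euc n} (hx : ‖x‖ = r) : 0 < radialDeriv u x := by
  set K := r ^ 2 * d / (2 * r + M) ^ 2 with hK
  have hK0 : 0 < K := by positivity
  have h1 : HasDerivAt (fun t : ℝ => u (t • x) + log t) (radialDeriv u x) 1 := by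
    simpa using hasDerivAt_ray hu x one_pos
  have h2 : HasDerivAt (fun t : ℝ => u (t⁻¹ • x) + log t⁻¹) (-radialDeriv u x) 1 := by
    have h3 : HasDerivAt (fun t : ℝ => t⁻¹) (-1) 1 := by
      simpa using hasDerivAt_inv (one_ne_zero : (1 : ℝ) ≠ 0)
    have h4 : HasDerivAt (fun t : ℝ => u (t • x) + log t) (radialDeriv u x) (1 : ℝ)⁻¹ := by
      simpa using h1
    have h5 := h4.comp 1 h3
    rw [mul_neg_one] at h5
    exact h5
  have h3 : HasDerivAt (fun t : ℝ => c * log (1 + (t ^ 2 - 1) * K)) (c * (2 * K)) 1 := by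
    have h4 : HasDerivAt (fun t : ℝ => 1 + (t ^ 2 - 1) * K) (2 * K) 1 := by
      simpa using (((hasDerivAt_pow 2 (1 : ℝ)).sub_const 1).mul_const K).const_add 1
    simpa using (h4.log (by simp)).const_mul c
  have h5 := nonneg_of_hasDerivAt_of_nonneg ((h1.sub h2).sub h3) (by simp) ?_
  · nlinarith [mul_pos hc hK0]
  · filter_upwards [Ioo_mem_nhdsGT (one_lt_two : (1 : ℝ) < 2)] with t ht
    have ht0 : 0 < t := one_pos.trans ht.1
    have hn : ‖t • x‖ = t * r := by rw [norm_smul, hx, Real.norm_of_nonneg ht0.le]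
    have h6 := h (t • x) (by rw [hn]; nlinarith [ht.1])
    rw [wDiff_smul hr ht0 hx, hn] at h6
    have h7 : 0 ≤ t ^ 2 - 1 := by nlinarith [ht.1]
    have h8 : (t ^ 2 - 1) * K ≤ ((t * r) ^ 2 - r ^ 2) * d / (t * r + M) ^ 2 := by
      have h9 : ((t * r) ^ 2 - r ^ 2) * d = (t ^ 2 - 1) * (r ^ 2 * d) := by ring
      rw [h9, mul_div_assoc, hK]
      have := ht.2.le
      gcongr
    have h10 := log_le_log (by positivity) (add_le_add_right h8 1)
    have h11 := mul_le_mul_of_nonneg_left h10 hc.le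
    simp only [Pi.sub_apply]
    linarith

/-- Near infinity strict domination is stable under perturbing the radius. -/
lemma eventually_wDiff_nonneg_at_infinity (hu : Continuous u) {r c d M : ℝ} (hr : 0 < r)
    (hc : 0 < c) (hd : 0 < d) (hM : 0 < M)
    (h : ∀ x, r < ‖x‖ → c * log (1 + (‖x‖ ^ 2 - r ^ 2) * d / (‖x‖ + M) ^ 2) ≤ wDiff u r x) :
    ∃ R, ∀ᶠ r' in 𝓝 r, ∀ x, R ≤ ‖x‖ → 0 ≤ wDiff u r' x := by
  set η := c * log (1 + 3 / 16 * d) with hη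
  have hη0 : 0 < η := mul_pos hc (log_pos (by linarith))
  have hnear : ∀ᶠ x in 𝓝 (0 : Euc n), |u x - u 0| < η / 4 := by
    have := hu.continuousAt.eventually (Metric.ball_mem_nhds (u 0) (by positivity : 0 < η / 4))
    simpa [Real.dist_eq] using this
  obtain ⟨δ, hδ, hball⟩ := Metric.eventually_nhds_iff_ball.1 hnear
  refine ⟨max (max (2 * r) M) (8 * r ^ 2 / δ), ?_⟩
  have hlog : ∀ᶠ r' in 𝓝 r, log r' < log r + η / 4 :=
    (continuousAt_log hr.ne').eventually (gt_mem_nhds (by linarith))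
  filter_upwards [hlog, lt_mem_nhds hr, gt_mem_nhds (by linarith : r < 2 * r)]
    with s hs hs0 hs2 x hx
  have hx1 : 2 * r ≤ ‖x‖ := (le_max_left _ _).trans ((le_max_left _ _).trans hx)
  have hx2 : M ≤ ‖x‖ := (le_max_right _ _).trans ((le_max_left _ _).trans hx)
  have hx3 : 8 * r ^ 2 / δ ≤ ‖x‖ := (le_max_right _ _).trans hx
  have hx0 : 0 < ‖x‖ := by linarith
  have hk : ∀ s, 0 < s → s < 2 * r → |u (kv s x) - u 0| < η / 4 := fun s hs0 hs2 => by
    refine hball _ ?_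
    rw [mem_ball_zero_iff, norm_kv, div_lt_iff₀ hx0]
    rw [div_le_iff₀ hδ] at hx3
    nlinarith
  have h1 := h x (by linarith)
  have h2 : η ≤ wDiff u r x := by
    refine le_trans ?_ h1
    rw [hη]
    have h3 : 3 / 16 * d ≤ (‖x‖ ^ 2 - r ^ 2) * d / (‖x‖ + M) ^ 2 := by
      rw [le_div_iff₀ (by positivity)]
      have h4 : 3 / 16 * (‖x‖ + M) ^ 2 ≤ ‖x‖ ^ 2 - r ^ 2 := by nlinarith
      nlinarith
    gcongr
  rw [wDiff_eq hr hx0] at h2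
  rw [wDiff_eq hs0 hx0]
  have h3 := abs_lt.1 (hk r hr (by linarith))
  have h4 := abs_lt.1 (hk s hs0 hs2)
  linarith

/-- Non-trivial domination is stable under perturbing the radius. -/
lemma eventually_dominates (hn : 2 ≤ n) (hμ0 : 0 < μ) (hμn : μ < n)
    (hu : ContDiff ℝ 1 u) (hB : CondB n μ u) (hIE : IE n μ u) {r : ℝ} (hr : 0 < r)
    (hW : Dominates u r) {x₀ : Euc n} (hx₀ : r < ‖x₀‖) (hw₀ : 0 < wDiff u r x₀) :
    ∀ᶠ r' in 𝓝 r, Dominates u r' := by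
  obtain ⟨c, d, M, hc, hd, hM, h⟩ := exists_wDiff_lower_bound hn hμ0 hμn hu hB hIE hr hW hx₀ hw₀
  obtain ⟨R, hR⟩ := eventually_wDiff_nonneg_at_infinity hu.continuous hr hc hd hM h
  have hK : ∀ᶠ r' in 𝓝 r, ∀ x ∈ closedBall (0 : Euc n) R, r' < ‖x‖ → 0 ≤ wDiff u r' x := by
    refine (isCompact_closedBall (0 : Euc n) R).eventually_forall_of_forall_eventually
      fun x _ => ?_
    rcases lt_trichotomy ‖x‖ r with hx | hx | hx
    · have h1 : ∀ᶠ p : ℝ × Euc n in 𝓝 (r, x), ‖p.2‖ < p.1 :=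
        (continuous_snd.norm.continuousAt).eventually_lt continuous_fst.continuousAt hx
      exact h1.mono fun p hp hp' => absurd hp hp'.not_gt
    · have hx0 : x ≠ 0 := norm_pos_iff.1 (hx ▸ hr)
      have h1 : ∀ᶠ y in 𝓝 x, 0 < radialDeriv u y :=
        (continuous_radialDeriv hu).continuousAt.eventually
          (lt_mem_nhds (radialDeriv_pos hu hr hc hd hM h hx))
      obtain ⟨δ, hδ, hball⟩ := Metric.eventually_nhds_iff_ball.1 h1
      have h2 : kv r x = x := by
        rw [kv_eq, hx, div_self (by positivity), one_smul]
      have h3 : ∀ᶠ p : ℝ × Euc n in 𝓝 (r, x), kv p.1 p.2 ∈ ball x δ := by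
        refine (continuousAt_kv_prod hx0).eventually ?_
        rw [show (fun p : ℝ × Euc n => kv p.1 p.2) (r, x) = x from h2]
        exact ball_mem_nhds x hδ
      have h4 : ∀ᶠ p : ℝ × Euc n in 𝓝 (r, x), p.2 ∈ ball x δ :=
        continuousAt_snd.eventually (ball_mem_nhds x hδ)
      have h5 : ∀ᶠ p : ℝ × Euc n in 𝓝 (r, x), 0 < p.1 :=
        continuousAt_fst.eventually (lt_mem_nhds hr)
      filter_upwards [h3, h4, h5] with p hp3 hp4 hp5 hp
      refine wDiff_nonneg_of_radialDeriv hu hp5 hp fun t ht => (hball _ ?_).le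
      rw [kv_eq] at hp3
      have h6 : Convex ℝ {t : ℝ | t • p.2 ∈ ball x δ} :=
        (convex_ball x δ).is_linear_preimage
          (IsLinearMap.mk (fun a b => add_smul a b p.2) fun a b => by rw [smul_eq_mul, mul_smul])
      exact h6.ordConnected.out hp3 (by simpa using hp4) ht
    · have hx0 : x ≠ 0 := norm_pos_iff.1 (hr.trans hx)
      have h1 : 0 < wDiff u r x := by
        refine lt_of_lt_of_le ?_ (h x hx)
        have h2 : 0 < ‖x‖ ^ 2 - r ^ 2 := by nlinarith
        refine mul_pos hc (log_pos ?_)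
        have : 0 < (‖x‖ ^ 2 - r ^ 2) * d / (‖x‖ + M) ^ 2 := by positivity
        linarith
      have h2 := (continuousAt_wDiff_prod hu.continuous hr hx0).eventually (lt_mem_nhds h1)
      exact h2.mono fun p hp _ => hp.le
  filter_upwards [hR, hK] with s hs1 hs2 x hx
  rcases le_total R ‖x‖ with h1 | h1
  · exact hs1 x h1
  · exact hs2 x (by simpa using h1) hx

end MovingSpheres

section Assembly

variable {n : ℕ} {μ : ℝ} {u : Euc n → ℝ}

lemma V_translate (b x : Euc n) : V n μ (fun y => u (b + y)) x = V n μ u (b + x) := by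
  rw [V, V, ← integral_add_left_eq_self
    (fun y => Real.exp ((2 * n - μ) / 2 * u y) / ‖b + x - y‖ ^ μ) b]
  simp only [add_sub_add_left_eq_sub]

lemma condB_translate (hB : CondB n μ u) (b : Euc n) : CondB n μ (fun y => u (b + y)) := by
  refine ⟨hB.1.comp_add_left b, ?_⟩
  have : (volume : Measure (Euc n × Euc n)).IsAddLeftInvariant :=
    inferInstanceAs ((volume : Measure (Euc n)).prod volume).IsAddLeftInvariant
  have h := hB.2.comp_add_left (b, b)
  simpa only [Prod.fst_add, Prod.snd_add, add_sub_add_left_eq_sub] using h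

lemma IE_translate (hn : 0 < n) (hμ0 : 0 < μ) (hμn : μ < n) (hu : Continuous u)
    (hB : CondB n μ u) (hIE : IE n μ u) (b : Euc n) : IE n μ (fun y => u (b + y)) := by
  obtain ⟨C, hC⟩ := hIE
  have hub : Continuous fun y => u (b + y) := hu.comp (continuous_const.add continuous_id)
  have hBb := condB_translate hB b
  have h0 := integrable_log_mul_curv hn hμ0 hμn hu hB b
  have h0' : Integrable fun y : Euc n => log ((‖b + y‖ + 1) / ‖y‖) * curv n μ u (b + y) := by
    simpa [norm_neg] using h0.comp_add_left b
  have h0b := integrable_log_mul_curv hn hμ0 hμn hub hBb 0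
  have hcb : ∀ y, curv n μ (fun y => u (b + y)) y = curv n μ u (b + y) := fun y => by
    rw [curv, curv, V_translate]
    rfl
  simp only [hcb, zero_sub, norm_neg] at h0b
  refine ⟨1 / betaN n * (∫ y, (log ((‖b + y‖ + 1) / ‖y‖) * curv n μ u (b + y) -
    log ((‖y‖ + 1) / ‖y‖) * curv n μ u (b + y))) + C, fun x => ?_⟩
  have hx := integrable_log_mul_curv hn hμ0 hμn hub hBb x
  simp only [hcb] at hx
  change u (b + x) = 1 / betaN n * (∫ y, log ((‖y‖ + 1) / ‖x - y‖) *
    curv n μ (fun y => u (b + y)) y) + _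
  have h1 : u (b + x) = 1 / betaN n * (∫ y, log ((‖y‖ + 1) / ‖b + x - y‖) * curv n μ u y) + C :=
    hC _
  rw [h1, ← add_assoc, ← mul_add, ← integral_add_left_eq_self _ b]
  simp only [hcb, add_sub_add_left_eq_sub]
  have hi : Integrable fun y : Euc n => log ((‖b + y‖ + 1) / ‖y‖) * curv n μ u (b + y) -
    log ((‖y‖ + 1) / ‖y‖) * curv n μ u (b + y) := h0'.sub h0b
  rw [← integral_add hx hi]
  congr 2
  refine integral_congr_ae ?_
  filter_upwards [ae_ne_point hn x, ae_ne_point hn 0] with y hxy hy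
  have h2 : ‖x - y‖ ≠ 0 := norm_ne_zero_iff.2 (sub_ne_zero.2 hxy)
  have h3 : ‖y‖ ≠ 0 := norm_ne_zero_iff.2 hy.symm
  have h4 : ‖y‖ + 1 ≠ 0 := by positivity
  have h5 : ‖b + y‖ + 1 ≠ 0 := by positivity
  rw [log_div h5 h2, log_div h4 h2, log_div h5 h3, log_div h4 h3]
  ring

lemma norm_unit_inversion (x : Euc n) : ‖(‖x‖ ^ 2)⁻¹ • x‖ = ‖x‖⁻¹ := by
  have h : (‖x‖ ^ 2)⁻¹ • x = kv 1 x := by rw [kv_eq, one_pow, one_div]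
  rw [h, norm_kv, one_pow, one_div]

lemma kv_unit_inversion {l : ℝ} {x : Euc n} (hx : 0 < ‖x‖) :
    kv l⁻¹ ((‖x‖ ^ 2)⁻¹ • x) = (l ^ 2)⁻¹ • x := by
  rw [kv_eq, norm_unit_inversion, smul_smul]
  congr 1
  field_simp

lemma wMS_eq {l : ℝ} (hl : 0 < l) (b : Euc n) {x : Euc n} (hx : 0 < ‖x‖) :
    wMS n u b l x = wDiff (fun y => u (b + y)) l⁻¹ ((‖x‖ ^ 2)⁻¹ • x) := by
  rw [wMS, wDiff, kv_unit_inversion hx, norm_unit_inversion,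
    log_div (by positivity) (by positivity), log_inv, log_inv]
  ring

lemma zMS_eq {l : ℝ} (hl : 0 < l) (b : Euc n) {x : Euc n} (hx : 0 < ‖x‖) :
    zMS n μ u b l x =
      ‖x‖ ^ (-μ) * zDiff n μ (fun y => u (b + y)) l⁻¹ ((‖x‖ ^ 2)⁻¹ • x) := by
  have h : ‖x‖ ^ (-μ) * (l⁻¹ / ‖x‖⁻¹) ^ μ = l ^ (-μ) := by
    rw [inv_div_inv, Real.div_rpow hx.le hl.le, Real.rpow_neg hx.le, Real.rpow_neg hl.le]
    have := (Real.rpow_pos_of_pos hx μ).ne'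
    field_simp
  rw [zMS, zDiff, kv_unit_inversion hx, norm_unit_inversion, V_translate, V_translate, mul_sub,
    ← mul_assoc, h]

lemma forall_wMS_zMS_nonneg_iff (hn : 0 < n) (hμ0 : 0 < μ) (hμn : μ < n) (hu : Continuous u)
    (hf : Integrable (dens n μ u)) (b : Euc n) {l : ℝ} (hl : 0 < l) :
    (∀ x, 0 < ‖x‖ → ‖x‖ < l → 0 ≤ wMS n u b l x ∧ 0 ≤ zMS n μ u b l x) ↔
      Dominates (fun y => u (b + y)) l⁻¹ := by
  constructor
  · intro h y hy
    have hy0 : 0 < ‖y‖ := (inv_pos.2 hl).trans hy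
    have h1 : ‖(‖y‖ ^ 2)⁻¹ • y‖ = ‖y‖⁻¹ := norm_unit_inversion y
    have h2 : 0 < ‖(‖y‖ ^ 2)⁻¹ • y‖ := by rw [h1]; positivity
    have h3 := (h _ h2 (by rw [h1]; exact inv_lt_of_inv_lt₀ hl hy)).1
    rw [wMS_eq hl b h2, h1, smul_smul] at h3
    have h4 : ((‖y‖⁻¹) ^ 2)⁻¹ * (‖y‖ ^ 2)⁻¹ = 1 := by field_simp
    rwa [h4, one_smul] at h3
  · intro h x hx hxl
    have h1 : l⁻¹ < ‖(‖x‖ ^ 2)⁻¹ • x‖ := by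
      rw [norm_unit_inversion]
      exact inv_strictAnti₀ hx hxl
    rw [wMS_eq hl b hx, zMS_eq hl b hx]
    have hub : Continuous fun y => u (b + y) := hu.comp (continuous_const.add continuous_id)
    exact ⟨h _ h1, mul_nonneg (by positivity)
      (zDiff_nonneg hn hμ0 hμn hub (hf.comp_add_left b) (inv_pos.2 hl) h h1)⟩

end Assembly

theorem lambda_positive_and_vanishing (n : ℕ) (hn : 2 ≤ n)
    (μ : ℝ) (hμ0 : 0 < μ) (hμn : μ < n)
    (u : EuclideanSpace ℝ (Fin n) → ℝ) (hu : ContDiff ℝ n u)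
    (hB : CondB n μ u) (hIE : IE n μ u) :
    ∀ b : EuclideanSpace ℝ (Fin n), 0 < lambdaB n μ u b ∧
      ∀ x : EuclideanSpace ℝ (Fin n), 0 < ‖x‖ → ‖x‖ < lambdaB n μ u b →
        wMS n u b (lambdaB n μ u b) x = 0 ∧ zMS n μ u b (lambdaB n μ u b) x = 0 := by
  intro b
  have hn0 : 0 < n := by lia
  have huc := hu.continuous
  set v : Euc n → ℝ := fun y => u (b + y) with hv
  have hv1 : ContDiff ℝ 1 v := by
    refine (hu.of_le ?_).comp (contDiff_const.add contDiff_id)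
    exact_mod_cast (by lia : 1 ≤ n)
  have hvB : CondB n μ v := condB_translate hB b
  have hvIE : IE n μ v := IE_translate hn0 hμ0 hμn huc hB hIE b
  have hiff := fun {l : ℝ} (hl : 0 < l) => forall_wMS_zMS_nonneg_iff hn0 hμ0 hμn huc hB.1 b hl
  set S := {l : ℝ | 0 < l ∧ ∀ ρ : ℝ, l ≤ ρ → ∀ x : EuclideanSpace ℝ (Fin n),
    0 < ‖x‖ → ‖x‖ < ρ → 0 ≤ wMS n u b ρ x ∧ 0 ≤ zMS n μ u b ρ x} with hS
  have hL : lambdaB n μ u b = sInf S := rfl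
  have hmem : ∀ {r : ℝ}, 0 < r → (r⁻¹ ∈ S ↔ ∀ s, 0 < s → s ≤ r → Dominates v s) := by
    intro r hr
    constructor
    · rintro ⟨_, h⟩ s hs hsr
      have h1 := (hiff (inv_pos.2 hs)).1 (h s⁻¹ (inv_anti₀ hs hsr))
      rwa [inv_inv] at h1
    · intro h
      refine ⟨inv_pos.2 hr, fun ρ hρ => ?_⟩
      have hρ0 : 0 < ρ := (inv_pos.2 hr).trans_le hρ
      exact (hiff hρ0).2 (h _ (inv_pos.2 hρ0) (inv_le_of_inv_le₀ hr hρ))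
  have hbdd : BddBelow S := ⟨0, fun l hl => hl.1.le⟩
  have hne : S.Nonempty := by
    obtain ⟨r₀, hr₀, h⟩ := exists_dominates hn hμ0 hμn hv1 hvB hvIE
    exact ⟨r₀⁻¹, (hmem hr₀).2 h⟩
  have hdom : ∀ r, 0 < r → sInf S < r⁻¹ → Dominates v r := by
    intro r hr h
    obtain ⟨l, hl, hlr⟩ := exists_lt_of_csInf_lt hne h
    have h1 := (hiff (inv_pos.2 hr)).1 (hl.2 _ hlr.le)
    rwa [inv_inv] at h1
  have hpos : 0 < sInf S := by
    by_contra! h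
    exact not_forall_dominates hn0 hμ0 hμn hv1.continuous hvB.1
      fun r hr => hdom r hr (h.trans_lt (inv_pos.2 hr))
  rw [hL]
  set L := sInf S with hLdef
  have hL' : 0 < L⁻¹ := inv_pos.2 hpos
  have hdL : Dominates v L⁻¹ := dominates_of_forall_lt hv1.continuous hL' fun r hr hrL =>
    hdom r hr ((lt_inv_comm₀ hr hpos).1 hrL)
  have hzero : ∀ x, L⁻¹ < ‖x‖ → wDiff v L⁻¹ x = 0 := by
    intro x hx
    refine le_antisymm (not_lt.1 fun hw => ?_) (hdL x hx)
    have h1 := eventually_dominates hn hμ0 hμn hv1 hvB hvIE hL' hdL hx hw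
    obtain ⟨ε, hε, h2⟩ := Metric.eventually_nhds_iff.1 h1
    have h3 : (L⁻¹ + ε / 2)⁻¹ ∈ S := by
      refine (hmem (by positivity)).2 fun s hs hsr => ?_
      rcases lt_or_ge s L⁻¹ with h4 | h4
      · exact hdom s hs ((lt_inv_comm₀ hs hpos).1 h4)
      · refine h2 ?_
        rw [Real.dist_eq, abs_lt]
        constructor <;> linarith
    have h4 := csInf_le hbdd h3
    have h5 : (L⁻¹ + ε / 2)⁻¹ < L := inv_lt_of_inv_lt₀ hpos (by linarith)
    exact absurd h4 h5.not_ge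
  refine ⟨hpos, fun x hx hxL => ?_⟩
  have h1 : L⁻¹ < ‖(‖x‖ ^ 2)⁻¹ • x‖ := by
    rw [norm_unit_inversion]
    exact inv_strictAnti₀ hx hxL
  rw [wMS_eq hpos b hx, zMS_eq hpos b hx]
  refine ⟨hzero _ h1, ?_⟩
  rw [zDiff_eq_zero hn0 hμ0 hμn hv1.continuous hvB.1 hL' hzero h1, mul_zero]
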